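/- arXiv:1210.5705 — 2 statements merged into one kernel-verified Lean document; each statement's English description precedes it below -/
import Mathlib

section
/- Let n ≥ 3 be an integer and let α ∈ ℝ satisfy (n + 4 - 2√(n² - n + 1))/3 ≤ α < n and α ≠ 4-n. Then the infimum, over all functions u : ℝⁿ → ℝ of class C² with compact support contained in ℝⁿ \ {0} and with ∫_{ℝⁿ} |x|^{α-2} |∇u(x)|² dx ≠ 0, of the quotient (∫_{ℝⁿ} |x|^α |Δu(x)|² dx) / (∫_{ℝⁿ} |x|^{α-2} |∇u(x)|² dx) equals ((n-α)/2)², i.e. the best constant coincides with the best constant among radial functions. -/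
open MeasureTheory

noncomputable def lap {n : ℕ} (u : EuclideanSpace ℝ (Fin n) → ℝ)
    (x : EuclideanSpace ℝ (Fin n)) : ℝ :=
  ∑ i : Fin n, iteratedFDeriv ℝ 2 u x ![EuclideanSpace.single i 1, EuclideanSpace.single i 1]

/-- The algebra of functions on a cylinder over the sphere, in logarithmic polar coordinates: `E` is
the axial derivative, `D i` the tangential derivatives, `ν` the radial unit vector, `J` the
    compactly
supported functions and `I` the integral. -/
structure SphericalCalculus (n : ℕ) (B : Type*) [CommRing B] [Algebra ℝ B] where
  D : Fin n → Derivation ℝ B B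
  E : Derivation ℝ B B
  ν : Fin n → B
  J : Ideal B
  I : B →ₗ[ℝ] ℝ
  sum_ν_mul_ν : ∑ i, ν i * ν i = 1
  D_ν : ∀ i j, D i (ν j) = (if i = j then 1 else 0) - ν i * ν j
  sum_ν_mul_D : ∀ f, ∑ i, ν i * D i f = 0
  D_D : ∀ i j f, D i (D j f) = D j (D i f) + ν i * D j f - ν j * D i f
  E_D : ∀ i f, E (D i f) = D i (E f)
  D_mem : ∀ i {f}, f ∈ J → D i f ∈ J
  E_mem : ∀ {f}, f ∈ J → E f ∈ J
  I_E : ∀ {f}, f ∈ J → I (E f) = 0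
  I_D : ∀ i {f}, f ∈ J → I (D i f) = ((n : ℝ) - 1) * I (ν i * f)
  I_mul_self_nonneg : ∀ {f}, f ∈ J → 0 ≤ I (f * f)

namespace SphericalCalculus

variable {n : ℕ} {B : Type*} [CommRing B] [Algebra ℝ B] (S : SphericalCalculus n B)

def lap (g : B) : B := ∑ i, S.D i (S.D i g)

def gradInner (f g : B) : B := ∑ i, S.D i f * S.D i g

lemma lap_mem {g : B} (hg : g ∈ S.J) : S.lap g ∈ S.J :=
  S.J.sum_mem fun i _ => S.D_mem i (S.D_mem i hg)

lemma I_sum_D_mul (f : Fin n → B) {h : B} (hh : h ∈ S.J) (hf : ∑ i, S.ν i * f i = 0) :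
    S.I (∑ i, S.D i (f i * h)) = 0 := by
  have h1 : ∀ i, S.I (S.D i (f i * h)) = ((n : ℝ) - 1) * S.I (S.ν i * f i * h) := fun _ => by
    rw [S.I_D _ (S.J.mul_mem_left _ hh), mul_assoc]
  rw [map_sum, Finset.sum_congr rfl fun i _ => h1 i, ← Finset.mul_sum, ← map_sum,
    ← Finset.sum_mul, hf, zero_mul, map_zero, mul_zero]

lemma I_mul_lap {f : B} (hf : f ∈ S.J) (g : B) :
    S.I (f * S.lap g) = - S.I (S.gradInner f g) := by
  have h := S.I_sum_D_mul (fun i => S.D i g) hf (S.sum_ν_mul_D g)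
  have h2 : ∑ i, S.D i (S.D i g * f) = f * S.lap g + S.gradInner f g := by
    simp only [Derivation.leibniz, smul_eq_mul, lap, gradInner, Finset.mul_sum,
      Finset.sum_add_distrib]
    rw [add_comm]
    congr 1
    exact Finset.sum_congr rfl fun i _ => mul_comm _ _
  rw [h2, map_add] at h
  linarith

lemma E_gradInner (f g : B) :
    S.E (S.gradInner f g) = S.gradInner (S.E f) g + S.gradInner f (S.E g) := by
  simp only [gradInner, map_sum, Derivation.leibniz, smul_eq_mul, S.E_D, Finset.sum_add_distrib]
  rw [add_comm]
  congr 1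
  exact Finset.sum_congr rfl fun i _ => mul_comm _ _

lemma gradInner_comm (f g : B) : S.gradInner f g = S.gradInner g f :=
  Finset.sum_congr rfl fun _ _ => mul_comm _ _

lemma gradInner_mem {f : B} (hf : f ∈ S.J) (g : B) : S.gradInner f g ∈ S.J :=
  S.J.sum_mem fun i _ => S.J.mul_mem_right _ (S.D_mem i hf)

lemma I_E_mul {f : B} (hf : f ∈ S.J) (g : B) : S.I (S.E f * g) = - S.I (f * S.E g) := by
  have h := S.I_E (S.J.mul_mem_right g hf)
  rw [Derivation.leibniz, map_add, smul_eq_mul, smul_eq_mul, mul_comm g] at h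
  linarith

def hess (g : B) (i j : Fin n) : B := S.D i (S.D j g) + S.ν j * S.D i g

lemma hess_symm (g : B) (i j : Fin n) : S.hess g i j = S.hess g j i := by
  rw [hess, hess, S.D_D i j]; ring

lemma sum_ν_mul_hess (g : B) (j : Fin n) : ∑ i, S.ν i * S.hess g i j = 0 := by
  have h1 : ∀ i, S.ν i * S.hess g i j = S.ν i * S.D i (S.D j g) + S.ν j * (S.ν i * S.D i g) :=
    fun i => by rw [hess]; ring
  rw [Finset.sum_congr rfl fun i _ => h1 i, Finset.sum_add_distrib, S.sum_ν_mul_D, ← Finset.mul_sum,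
    S.sum_ν_mul_D, mul_zero, add_zero]

lemma sum_hess_self (g : B) : ∑ i, S.hess g i i = S.lap g := by
  simp only [hess, Finset.sum_add_distrib, S.sum_ν_mul_D, add_zero, lap]

lemma sum_ν_mul_D_D (g : B) (j : Fin n) : ∑ i, S.ν i * S.D j (S.D i g) = - S.D j g := by
  have h := S.sum_ν_mul_hess g j
  simp only [S.hess_symm g _ j] at h
  simp only [hess, mul_add, Finset.sum_add_distrib, ← mul_assoc, ← Finset.sum_mul,
    S.sum_ν_mul_ν, one_mul] at h
  exact eq_neg_of_add_eq_zero_left h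

lemma sum_D_ν : ∑ i, S.D i (S.ν i) = (n : B) - 1 := by
  simp [S.D_ν, Finset.sum_sub_distrib, S.sum_ν_mul_ν]

lemma sum_D_hess (g : B) (j : Fin n) :
    ∑ i, S.D i (S.hess g i j) =
      S.D j (S.lap g) + ((n : B) - 2) * S.D j g - S.ν j * S.lap g := by
  have h1 : ∀ i, S.D i (S.hess g i j) = S.D j (S.D i (S.D i g)) + S.ν i * S.D j (S.D i g)
      - S.ν j * S.D i (S.D i g) + S.ν i * S.D i (S.D j g) + S.D j g * S.D i (S.ν i) := fun i => by
    rw [S.hess_symm, hess, map_add, Derivation.leibniz, S.D_D i j (S.D i g), smul_eq_mul,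
      smul_eq_mul]
    ring
  rw [Finset.sum_congr rfl fun i _ => h1 i]
  simp only [Finset.sum_add_distrib, Finset.sum_sub_distrib, ← Finset.mul_sum, ← map_sum]
  rw [S.sum_ν_mul_D_D, S.sum_ν_mul_D, S.sum_D_ν, ← lap]
  ring

lemma sum_D_mul_hess (g : B) (i : Fin n) :
    ∑ j, S.D i (S.D j g) * S.hess g i j = ∑ j, S.hess g i j * S.hess g i j := by
  have h1 : ∀ j, S.D i (S.D j g) * S.hess g i j
      = S.hess g i j * S.hess g i j - S.D i g * (S.ν j * S.hess g j i) := fun j => by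
    rw [S.hess_symm g j i, hess]; ring
  rw [Finset.sum_congr rfl fun j _ => h1 j, Finset.sum_sub_distrib, ← Finset.mul_sum,
    S.sum_ν_mul_hess, mul_zero, sub_zero]

/-- Integrated Bochner formula on the sphere. -/
lemma bochner {g : B} (hg : g ∈ S.J) :
    S.I (S.lap g * S.lap g) = S.I (∑ i, ∑ j, S.hess g i j * S.hess g i j)
      + ((n : ℝ) - 2) * S.I (S.gradInner g g) := by
  have key : ∑ j, ∑ i, S.D i (S.hess g i j * S.D j g) =
      ∑ i, ∑ j, S.hess g i j * S.hess g i j + S.gradInner g (S.lap g)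
        + ((n : B) - 2) * S.gradInner g g := by
    have h1 : ∀ j, ∑ i, S.D i (S.hess g i j * S.D j g) =
        ∑ i, S.D i (S.D j g) * S.hess g i j + (S.D j g * S.D j (S.lap g)
          + ((n : B) - 2) * (S.D j g * S.D j g) - S.lap g * (S.ν j * S.D j g)) := fun j => by
      simp only [Derivation.leibniz, smul_eq_mul, Finset.sum_add_distrib, ← Finset.mul_sum,
        S.sum_D_hess]
      rw [Finset.sum_congr rfl fun i _ => mul_comm (S.hess g i j) _]
      ring
    rw [Finset.sum_congr rfl fun j _ => h1 j]
    simp only [Finset.sum_add_distrib, Finset.sum_sub_distrib, ← Finset.mul_sum, S.sum_ν_mul_D]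
    rw [Finset.sum_comm, Finset.sum_congr rfl fun i _ => S.sum_D_mul_hess g i, gradInner,
      gradInner]
    ring
  have h0 : S.I (∑ j, ∑ i, S.D i (S.hess g i j * S.D j g)) = 0 := by
    rw [map_sum]
    exact Finset.sum_eq_zero fun j _ => S.I_sum_D_mul _ (S.D_mem j hg) (S.sum_ν_mul_hess g j)
  have hc : ((n : B) - 2) * S.gradInner g g = ((n : ℝ) - 2) • S.gradInner g g := by
    rw [Algebra.smul_def]; simp [map_ofNat]
  rw [key, map_add, map_add, hc, map_smul, smul_eq_mul, S.gradInner_comm,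
    ← neg_eq_iff_eq_neg.mpr (S.I_mul_lap (S.lap_mem hg) g)] at h0
  linarith

lemma sum_hess_sub_sq (g : B) (c : B) :
    ∑ i, ∑ j, (S.hess g i j - c * ((if i = j then 1 else 0) - S.ν i * S.ν j)) *
        (S.hess g i j - c * ((if i = j then 1 else 0) - S.ν i * S.ν j)) =
      ∑ i, ∑ j, S.hess g i j * S.hess g i j - 2 * c * S.lap g + c * c * ((n : B) - 1) := by
  have h1 : ∀ i j, (S.hess g i j - c * ((if i = j then 1 else 0) - S.ν i * S.ν j)) *
        (S.hess g i j - c * ((if i = j then 1 else 0) - S.ν i * S.ν j)) =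
      S.hess g i j * S.hess g i j - 2 * c * (if i = j then S.hess g i j else 0)
       + 2 * c * (S.ν j * (S.ν i * S.hess g i j))
       + c * c * ((if i = j then 1 - 2 * S.ν i * S.ν j else 0)
        + (S.ν i * S.ν i) * (S.ν j * S.ν j)) := fun i j => by
    split_ifs <;> ring
  have h2 : ∑ i, ∑ j, S.ν j * (S.ν i * S.hess g i j) = 0 := by
    rw [Finset.sum_comm]
    simp only [← Finset.mul_sum, S.sum_ν_mul_hess, mul_zero, Finset.sum_const_zero]
  simp only [h1, Finset.sum_add_distrib, Finset.sum_sub_distrib, ← Finset.mul_sum, h2,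
    Finset.sum_ite_eq, Finset.mem_univ, if_true, S.sum_hess_self, S.sum_ν_mul_ν, mul_one,
    mul_assoc, mul_zero]
  simp
  ring

/-- Lichnerowicz estimate on the sphere. -/
lemma lichnerowicz (hn : 3 ≤ n) {g : B} (hg : g ∈ S.J) :
    ((n : ℝ) - 1) * S.I (S.gradInner g g) ≤ S.I (S.lap g * S.lap g) := by
  have hn' : (3 : ℝ) ≤ n := by exact_mod_cast hn
  have hn0 : (0 : ℝ) < (n : ℝ) - 1 := by linarith
  have hJ : ∀ i j, S.hess g i j ∈ S.J := fun i j =>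
    S.J.add_mem (S.D_mem i (S.D_mem j hg)) (S.J.mul_mem_left _ (S.D_mem i hg))
  set c : B := ((n : ℝ) - 1)⁻¹ • S.lap g with hc
  have hcJ : c ∈ S.J := by
    rw [hc, Algebra.smul_def]; exact S.J.mul_mem_left _ (S.lap_mem hg)
  have hpos : 0 ≤ S.I (∑ i, ∑ j, (S.hess g i j - c * ((if i = j then 1 else 0) - S.ν i * S.ν j)) *
        (S.hess g i j - c * ((if i = j then 1 else 0) - S.ν i * S.ν j))) := by
    rw [map_sum]
    refine Finset.sum_nonneg fun i _ => ?_
    rw [map_sum]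
    exact Finset.sum_nonneg fun j _ =>
      S.I_mul_self_nonneg (S.J.sub_mem (hJ i j) (S.J.mul_mem_right _ hcJ))
  have e : ∑ i, ∑ j, S.hess g i j * S.hess g i j - 2 * c * S.lap g + c * c * ((n : B) - 1) =
      ∑ i, ∑ j, S.hess g i j * S.hess g i j - ((n : ℝ) - 1)⁻¹ • (S.lap g * S.lap g) := by
    have e1 : c * ((n : B) - 1) = S.lap g := by
      have : ((n : B) - 1) = algebraMap ℝ B ((n : ℝ) - 1) := by simp
      rw [hc, mul_comm, this, ← Algebra.smul_def, smul_smul, mul_inv_cancel₀ hn0.ne', one_smul]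
    rw [mul_assoc c c, e1, hc, ← smul_mul_assoc]
    ring
  rw [S.sum_hess_sub_sq, e, map_sub, map_smul, smul_eq_mul] at hpos
  have hb := S.bochner hg
  have hmul : ((n : ℝ) - 1) * (((n : ℝ) - 1)⁻¹ * S.I (S.lap g * S.lap g))
      = S.I (S.lap g * S.lap g) := by
    rw [← mul_assoc, mul_inv_cancel₀ hn0.ne', one_mul]
  have := mul_le_mul_of_nonneg_left hpos hn0.le
  rw [mul_sub, hmul] at this
  have h3 : 0 < (n : ℝ) - 2 := by linarith
  refine le_of_mul_le_mul_left ?_ h3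
  nlinarith

lemma I_mul_E_self {f : B} (hf : f ∈ S.J) : S.I (f * S.E f) = 0 := by
  have h := S.I_E_mul hf f
  rw [mul_comm] at h
  linarith

lemma I_cylinder_sq {g : B} (hg : g ∈ S.J) (a b : ℝ) :
    S.I ((S.E (S.E g) + a • S.E g + b • g + S.lap g) *
        (S.E (S.E g) + a • S.E g + b • g + S.lap g)) =
      S.I (S.E (S.E g) * S.E (S.E g)) + (a ^ 2 - 2 * b) * S.I (S.E g * S.E g)
      + b ^ 2 * S.I (g * g) + 2 * S.I (S.gradInner (S.E g) (S.E g))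
      + S.I (S.lap g * S.lap g) - 2 * b * S.I (S.gradInner g g) := by
  have hE := S.E_mem hg
  have hEE := S.E_mem hE
  have h1 := S.I_mul_E_self hg
  have h2 := S.I_mul_E_self hE
  have h3 := S.I_E_mul hE g
  have h4 := S.I_mul_lap hEE g
  have h5 := S.I_mul_lap hE g
  have h6 := S.I_mul_lap hg g
  have h7 := S.I_E (S.gradInner_mem hE g)
  have h8 := S.I_E (S.gradInner_mem hg g)
  rw [E_gradInner, map_add] at h7 h8
  rw [S.gradInner_comm g] at h8
  have e : (S.E (S.E g) + a • S.E g + b • g + S.lap g) *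
        (S.E (S.E g) + a • S.E g + b • g + S.lap g) =
      S.E (S.E g) * S.E (S.E g) + (a ^ 2) • (S.E g * S.E g) + (b ^ 2) • (g * g)
      + S.lap g * S.lap g + (2 * a) • (S.E g * S.E (S.E g)) + (2 * b) • (S.E (S.E g) * g)
      + (2 : ℝ) • (S.E (S.E g) * S.lap g) + (2 * a * b) • (g * S.E g)
      + (2 * a) • (S.E g * S.lap g) + (2 * b) • (g * S.lap g) := by
    simp only [Algebra.smul_def, map_mul, map_pow, map_ofNat]
    ring
  simp only [e, map_add, map_smul, smul_eq_mul, h1, h2, h3, h4, h5, h6]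
  linear_combination -2 * h7 - a * h8

def energy (γ δ : ℝ) (g : B) : ℝ :=
  S.I ((S.E (S.E g) + (δ - γ) • S.E g + (-(γ * δ)) • g + S.lap g) *
    (S.E (S.E g) + (δ - γ) • S.E g + (-(γ * δ)) • g + S.lap g))

def dirichlet (γ : ℝ) (g : B) : ℝ :=
  S.I ((S.E g + (-γ) • g) * (S.E g + (-γ) • g) + S.gradInner g g)

lemma dirichlet_eq (γ : ℝ) {g : B} (hg : g ∈ S.J) :
    S.dirichlet γ g = S.I (S.E g * S.E g) + γ ^ 2 * S.I (g * g) + S.I (S.gradInner g g) := by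
  have h1 := S.I_mul_E_self hg
  have e : (S.E g + (-γ) • g) * (S.E g + (-γ) • g) + S.gradInner g g =
      S.E g * S.E g + (γ ^ 2) • (g * g) + S.gradInner g g + (-2 * γ) • (g * S.E g) := by
    simp only [Algebra.smul_def, map_mul, map_pow, map_ofNat, map_neg]
    ring
  simp only [dirichlet, e, map_add, map_smul, smul_eq_mul, h1]
  ring

lemma energy_eq (γ δ : ℝ) {g : B} (hg : g ∈ S.J) :
    S.energy γ δ g = δ ^ 2 * S.dirichlet γ g + S.I (S.E (S.E g) * S.E (S.E g))
      + γ ^ 2 * S.I (S.E g * S.E g) + 2 * S.I (S.gradInner (S.E g) (S.E g))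
      + S.I (S.lap g * S.lap g) + (2 * γ * δ - δ ^ 2) * S.I (S.gradInner g g) := by
  rw [energy, S.I_cylinder_sq hg, S.dirichlet_eq γ hg]
  ring

lemma I_gradInner_self_nonneg {g : B} (hg : g ∈ S.J) : 0 ≤ S.I (S.gradInner g g) := by
  rw [gradInner, map_sum]
  exact Finset.sum_nonneg fun i _ => S.I_mul_self_nonneg (S.D_mem i hg)

theorem dirichlet_le_energy (hn : 3 ≤ n) {γ δ : ℝ}
    (h : 0 ≤ (n : ℝ) - 1 + 2 * γ * δ - δ ^ 2) {g : B} (hg : g ∈ S.J) :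
    δ ^ 2 * S.dirichlet γ g ≤ S.energy γ δ g := by
  rw [S.energy_eq γ δ hg]
  have h1 := S.I_mul_self_nonneg (S.E_mem hg)
  have h2 := S.I_mul_self_nonneg (S.E_mem (S.E_mem hg))
  have h3 := S.I_gradInner_self_nonneg (S.E_mem hg)
  have h4 := S.I_gradInner_self_nonneg hg
  have h5 := S.lichnerowicz hn hg
  nlinarith [mul_nonneg (sq_nonneg γ) h1, mul_nonneg h h4]

theorem energy_eq_of_radial (γ δ : ℝ) {g : B} (hg : g ∈ S.J) (hr : ∀ i, S.D i g = 0) :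
    S.energy γ δ g = δ ^ 2 * S.dirichlet γ g + S.I (S.E (S.E g) * S.E (S.E g))
      + γ ^ 2 * S.I (S.E g * S.E g) := by
  have h1 : S.gradInner g g = 0 := by simp [gradInner, hr]
  have h2 : S.gradInner (S.E g) (S.E g) = 0 := by simp [gradInner, ← S.E_D, hr]
  have h3 : S.lap g = 0 := by simp [lap, hr]
  rw [S.energy_eq γ δ hg, h1, h2, h3]
  simp

end SphericalCalculus

/-- The algebra of functions on punctured Euclidean space, with `P i` the partial derivatives, `X i`
the coordinates, `ρ a` the power `r ^ a` of the radius, `J` the compactly supported functions and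
`I` the integral. -/
structure PuncturedCalculus (n : ℕ) (B : Type*) [CommRing B] [Algebra ℝ B] where
  P : Fin n → Derivation ℝ B B
  X : Fin n → B
  ρ : ℝ → B
  J : Ideal B
  I : B →ₗ[ℝ] ℝ
  P_comm : ∀ i j f, P i (P j f) = P j (P i f)
  P_X : ∀ i j, P i (X j) = if i = j then 1 else 0
  ρ_zero : ρ 0 = 1
  ρ_add : ∀ a b, ρ (a + b) = ρ a * ρ b
  ρ_two : ρ 2 = ∑ i, X i * X i
  P_ρ : ∀ i a, P i (ρ a) = a • (ρ (a - 2) * X i)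
  P_mem : ∀ i {f}, f ∈ J → P i f ∈ J
  I_P : ∀ i {f}, f ∈ J → I (P i f) = 0
  I_mul_self_nonneg : ∀ {f}, f ∈ J → 0 ≤ I (f * f)

namespace PuncturedCalculus

variable {n : ℕ} {B : Type*} [CommRing B] [Algebra ℝ B] (C : PuncturedCalculus n B)

def euler : Derivation ℝ B B := ∑ i, C.X i • C.P i

def ν (i : Fin n) : B := C.ρ (-1) * C.X i

def tang (i : Fin n) : Derivation ℝ B B := C.ρ 1 • C.P i - C.ν i • C.euler

lemma euler_apply (f : B) : C.euler f = ∑ i, C.X i * C.P i f := by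
  have h : ∀ s : Finset (Fin n), (∑ i ∈ s, C.X i • C.P i) f = ∑ i ∈ s, C.X i * C.P i f := fun s
      => by
    induction s using Finset.cons_induction with
    | empty => simp
    | cons a s ha ih => rw [Finset.sum_cons, Finset.sum_cons, Derivation.add_apply, ih]; rfl
  exact h Finset.univ

lemma tang_apply (i : Fin n) (f : B) : C.tang i f = C.ρ 1 * C.P i f - C.ν i * C.euler f := by
  simp [tang]

lemma ρ_mul_ρ {a b c : ℝ} (h : a + b = c) : C.ρ a * C.ρ b = C.ρ c := by
  rw [← h, C.ρ_add]

lemma sum_ν_mul_ν : ∑ i, C.ν i * C.ν i = 1 := by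
  have h : ∀ i, C.ν i * C.ν i = C.ρ (-2) * (C.X i * C.X i) := fun i => by
    rw [← C.ρ_mul_ρ (show (-1 : ℝ) + -1 = -2 by norm_num), ν]; ring
  rw [Finset.sum_congr rfl fun i _ => h i, ← Finset.mul_sum, ← C.ρ_two,
    C.ρ_mul_ρ (show (-2 : ℝ) + 2 = 0 by norm_num), C.ρ_zero]

lemma sum_ν_mul_P (f : B) : ∑ i, C.ν i * C.P i f = C.ρ (-1) * C.euler f := by
  rw [C.euler_apply, Finset.mul_sum]
  exact Finset.sum_congr rfl fun i _ => by rw [ν]; ring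

lemma ρ_one_mul_ρ_neg_one : C.ρ 1 * C.ρ (-1) = 1 := by
  rw [C.ρ_mul_ρ (show (1 : ℝ) + -1 = 0 by norm_num), C.ρ_zero]

lemma ρ_one_mul_ν (i : Fin n) : C.ρ 1 * C.ν i = C.X i := by
  rw [ν, ← mul_assoc, C.ρ_one_mul_ρ_neg_one, one_mul]

lemma euler_X (i : Fin n) : C.euler (C.X i) = C.X i := by
  simp [C.euler_apply, C.P_X]

lemma euler_ρ (a : ℝ) : C.euler (C.ρ a) = a • C.ρ a := by
  have h : ∀ i, C.X i * C.P i (C.ρ a) = (a • C.ρ (a - 2)) * (C.X i * C.X i) := fun i => by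
    rw [C.P_ρ, Algebra.smul_def, Algebra.smul_def]; ring
  rw [C.euler_apply, Finset.sum_congr rfl fun i _ => h i, ← Finset.mul_sum, ← C.ρ_two,
    smul_mul_assoc, C.ρ_mul_ρ (show a - 2 + 2 = a by ring)]

lemma euler_ν (i : Fin n) : C.euler (C.ν i) = 0 := by
  rw [ν, Derivation.leibniz, C.euler_ρ, C.euler_X]
  simp only [smul_eq_mul, Algebra.smul_def, map_neg, map_one]
  ring

lemma tang_ρ (i : Fin n) (a : ℝ) : C.tang i (C.ρ a) = 0 := by
  rw [C.tang_apply, C.euler_ρ, C.P_ρ, ← C.ρ_mul_ρ (show -1 + (a + -1) = a - 2 by ring),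
    C.ρ_add a, ← C.ρ_one_mul_ν]
  have h := C.ρ_one_mul_ρ_neg_one
  have h2 : C.ρ a = C.ρ 1 * C.ρ (-1) * C.ρ a := by rw [h, one_mul]
  simp only [Algebra.smul_def]
  linear_combination (algebraMap ℝ B a * C.ρ a * C.ν i) * (C.ρ 1 * C.ρ (-1) + 1) * h

lemma tang_ν (i j : Fin n) :
    C.tang i (C.ν j) = (if i = j then 1 else 0) - C.ν i * C.ν j := by
  rw [C.tang_apply, C.euler_ν, ν, Derivation.leibniz, C.P_ρ, C.P_X,
    ← C.ρ_mul_ρ (show -1 + (-1 + -1) = (-1 - 2 : ℝ) by ring),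
    ← C.ρ_mul_ρ (show (-1 + -1 : ℝ) = -1 + -1 by ring)]
  have h := C.ρ_one_mul_ρ_neg_one
  simp only [smul_eq_mul, Algebra.smul_def, map_neg, map_one, ν]
  split_ifs
  · linear_combination (1 - C.ρ (-1) * C.ρ (-1) * C.X i * C.X j) * h
  · linear_combination (-(C.ρ (-1) * C.ρ (-1) * C.X i * C.X j)) * h

lemma sum_ν_mul_tang (f : B) : ∑ i, C.ν i * C.tang i f = 0 := by
  have h : ∀ i, C.ν i * C.tang i f = C.ρ 1 * (C.ν i * C.P i f) - C.ν i * C.ν i * C.euler f :=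
    fun i => by rw [C.tang_apply]; ring
  rw [Finset.sum_congr rfl fun i _ => h i, Finset.sum_sub_distrib, ← Finset.mul_sum,
    ← Finset.sum_mul, C.sum_ν_mul_P, C.sum_ν_mul_ν, ← mul_assoc, C.ρ_one_mul_ρ_neg_one, sub_self]

lemma P_euler (i : Fin n) (f : B) : C.P i (C.euler f) = C.P i f + C.euler (C.P i f) := by
  simp [C.euler_apply, Derivation.leibniz, Finset.sum_add_distrib, C.P_X, C.P_comm i, add_comm]

lemma euler_tang (i : Fin n) (f : B) : C.euler (C.tang i f) = C.tang i (C.euler f) := by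
  rw [C.tang_apply, C.tang_apply, map_sub, Derivation.leibniz, Derivation.leibniz, C.euler_ρ,
    C.euler_ν, C.P_euler]
  simp only [smul_eq_mul, one_smul]
  ring

lemma tang_tang (i j : Fin n) (f : B) :
    C.tang i (C.tang j f) = C.tang j (C.tang i f) + C.ν i * C.tang j f - C.ν j * C.tang i f := by
  have h : ∀ i j, C.tang i (C.tang j f) = C.ρ 1 * (C.ρ 1 * C.P i (C.P j f)
      - C.ν i * C.euler (C.P j f)) - ((if i = j then 1 else 0) - C.ν i * C.ν j) * C.euler f
      - C.ν j * (C.ρ 1 * C.P i f + C.ρ 1 * C.euler (C.P i f) - C.ν i * C.euler (C.euler f)) :=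
    fun i j => by
    rw [C.tang_apply j, map_sub, Derivation.leibniz, Derivation.leibniz, C.tang_ρ, C.tang_ν,
      C.tang_apply i (C.P j f), C.tang_apply i (C.euler f), C.P_euler]
    simp only [smul_eq_mul]
    ring
  rw [h i j, h j i, C.P_comm i j, C.tang_apply, C.tang_apply]
  simp only [eq_comm (a := j)]
  ring

lemma sum_tang_tang (f : B) :
    ∑ i, C.tang i (C.tang i f) = C.ρ 2 * (∑ i, C.P i (C.P i f)) - C.euler (C.euler f)
      - ((n : B) - 2) * C.euler f := by
  have hν : ∀ i, C.ν i = C.ρ (-1) * C.X i := fun _ => rfl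
  have h : ∀ i, C.tang i (C.tang i f) = C.ρ 2 * C.P i (C.P i f) - C.X i * C.euler (C.P i f)
      - (C.euler f - C.ν i * C.ν i * C.euler f) - C.ν i * C.tang i (C.euler f) := fun i => by
    conv_lhs => rw [C.tang_apply i f]
    rw [map_sub, Derivation.leibniz, Derivation.leibniz, C.tang_ρ, C.tang_ν,
      C.tang_apply i (C.P i f), ← C.ρ_mul_ρ (show (1 + 1 : ℝ) = 2 by norm_num),
      ← C.ρ_one_mul_ν i]
    simp only [smul_eq_mul, if_true]
    ring
  have h2 : ∑ i, C.X i * C.euler (C.P i f) = C.euler (C.euler f) - C.euler f := by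
    have h3 : ∀ i, C.X i * C.euler (C.P i f) = C.X i * C.P i (C.euler f) - C.X i * C.P i f :=
      fun i => by rw [C.P_euler]; ring
    rw [Finset.sum_congr rfl fun i _ => h3 i, Finset.sum_sub_distrib, ← C.euler_apply,
      ← C.euler_apply]
  rw [Finset.sum_congr rfl fun i _ => h i]
  simp only [Finset.sum_sub_distrib, ← Finset.mul_sum, ← Finset.sum_mul, C.sum_ν_mul_ν, h2,
    C.sum_ν_mul_tang]
  simp
  ring

lemma euler_mem {f : B} (hf : f ∈ C.J) : C.euler f ∈ C.J := by
  rw [C.euler_apply]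
  exact C.J.sum_mem fun i _ => C.J.mul_mem_left _ (C.P_mem i hf)

lemma tang_mem (i : Fin n) {f : B} (hf : f ∈ C.J) : C.tang i f ∈ C.J := by
  rw [C.tang_apply]
  exact C.J.sub_mem (C.J.mul_mem_left _ (C.P_mem i hf)) (C.J.mul_mem_left _ (C.euler_mem hf))

lemma I_euler {f : B} (hf : f ∈ C.J) : C.I (C.euler f) = -(n * C.I f) := by
  have h : ∀ i, C.I (C.X i * C.P i f) = - C.I f := fun i => by
    have h1 := C.I_P i (C.J.mul_mem_left (C.X i) hf)
    rw [Derivation.leibniz, C.P_X, if_pos rfl, map_add, smul_eq_mul, smul_eq_mul, mul_one] at h1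
    linarith
  rw [C.euler_apply, map_sum, Finset.sum_congr rfl fun i _ => h i]
  simp

lemma I_ρ_mul_euler {f : B} (hf : f ∈ C.J) : C.I (C.ρ (-n) * C.euler f) = 0 := by
  have h := C.I_euler (C.J.mul_mem_left (C.ρ (-n)) hf)
  rw [Derivation.leibniz, C.euler_ρ, smul_eq_mul, smul_eq_mul, mul_smul_comm, map_add, map_smul,
    smul_eq_mul, mul_comm f] at h
  linarith

lemma I_ρ_mul_tang (i : Fin n) {f : B} (hf : f ∈ C.J) :
    C.I (C.ρ (-n) * C.tang i f) = ((n : ℝ) - 1) * C.I (C.ρ (-n) * (C.ν i * f)) := by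
  have h1 := C.I_ρ_mul_euler (C.J.mul_mem_left (C.ν i) hf)
  rw [Derivation.leibniz, C.euler_ν, smul_zero, add_zero, smul_eq_mul] at h1
  have h2 := C.I_P i (C.J.mul_mem_left (C.ρ (-n + 1)) hf)
  have e : f * (C.ρ (-n + 1 - 2) * C.X i) = C.ρ (-n) * (C.ν i * f) := by
    rw [ν, show (-n + 1 - 2 : ℝ) = -n + -1 by ring, C.ρ_add]; ring
  rw [Derivation.leibniz, C.P_ρ, smul_eq_mul, smul_eq_mul, mul_smul_comm, map_add, map_smul,
    smul_eq_mul, e, C.ρ_add] at h2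
  rw [C.tang_apply, mul_sub, map_sub, h1, ← mul_assoc]
  linarith

def spherical : SphericalCalculus n B where
  D := C.tang
  E := C.euler
  ν := C.ν
  J := C.J
  I := C.I ∘ₗ LinearMap.mulLeft ℝ (C.ρ (-n))
  sum_ν_mul_ν := C.sum_ν_mul_ν
  D_ν := C.tang_ν
  sum_ν_mul_D := C.sum_ν_mul_tang
  D_D := C.tang_tang
  E_D := C.euler_tang
  D_mem := C.tang_mem
  E_mem := C.euler_mem
  I_E := C.I_ρ_mul_euler
  I_D := C.I_ρ_mul_tang
  I_mul_self_nonneg := fun {f} hf => by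
    have h := C.I_mul_self_nonneg (C.J.mul_mem_left (C.ρ (-n / 2)) hf)
    have e : C.ρ (-n / 2) * f * (C.ρ (-n / 2) * f) = C.ρ (-n) * (f * f) := by
      rw [← C.ρ_mul_ρ (show (-n / 2 + -n / 2 : ℝ) = -n by ring)]; ring
    rwa [e] at h

lemma spherical_D (i : Fin n) (f : B) : C.spherical.D i f = C.tang i f := rfl

lemma spherical_E (f : B) : C.spherical.E f = C.euler f := rfl

lemma spherical_I (f : B) : C.spherical.I f = C.I (C.ρ (-n) * f) := rfl

def lap (u : B) : B := ∑ i, C.P i (C.P i u)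

lemma sum_P_mul_P (u : B) :
    C.ρ 2 * ∑ i, C.P i u * C.P i u = C.euler u * C.euler u + ∑ i, C.tang i u * C.tang i u := by
  have h : ∀ i, C.tang i u * C.tang i u = C.ρ 2 * (C.P i u * C.P i u)
      - 2 * C.euler u * (C.X i * C.P i u) + C.ν i * C.ν i * (C.euler u * C.euler u) := fun i => by
    rw [C.tang_apply, ← C.ρ_mul_ρ (show (1 + 1 : ℝ) = 2 by norm_num), ← C.ρ_one_mul_ν i]
    ring
  rw [Finset.sum_congr rfl fun i _ => h i, Finset.sum_add_distrib, Finset.sum_sub_distrib,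
    ← Finset.mul_sum, ← Finset.mul_sum, ← Finset.sum_mul, C.sum_ν_mul_ν, ← C.euler_apply]
  ring

variable {γ δ α : ℝ}

lemma I_lap_sq (hγ : γ = (n - 4 + α) / 2) (hδ : δ = (n - α) / 2) (g : B) :
    C.I (C.ρ α * (C.lap (C.ρ (-γ) * g) * C.lap (C.ρ (-γ) * g))) =
      C.spherical.energy γ δ g := by
  have h1 : C.ρ 2 * C.lap (C.ρ (-γ) * g) = C.ρ (-γ) * (C.euler (C.euler g) + (δ - γ) • C.euler g
      + (-(γ * δ)) • g + C.spherical.lap g) := by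
    have h2 := C.sum_tang_tang (C.ρ (-γ) * g)
    have h3 : ∑ i, C.tang i (C.tang i (C.ρ (-γ) * g)) = C.ρ (-γ) * C.spherical.lap g := by
      simp only [Derivation.leibniz, C.tang_ρ, smul_eq_mul, mul_zero, add_zero, Finset.mul_sum,
        SphericalCalculus.lap, spherical_D]
    have hn : (n : B) = algebraMap ℝ B (γ + δ + 2) := by
      rw [show γ + δ + 2 = (n : ℝ) by rw [hγ, hδ]; ring]; simp
    rw [h3, hn, ← lap] at h2
    generalize C.lap (C.ρ (-γ) * g) = L at h2 ⊢
    simp only [Derivation.leibniz, C.euler_ρ, smul_eq_mul, map_add, Algebra.smul_def, map_neg,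
      map_sub, map_mul, map_ofNat, Derivation.map_algebraMap (C.euler)] at h2 ⊢
    linear_combination -h2
  have h4 : C.ρ α * (C.lap (C.ρ (-γ) * g) * C.lap (C.ρ (-γ) * g)) =
      C.ρ (α - 4) * ((C.ρ 2 * C.lap (C.ρ (-γ) * g)) * (C.ρ 2 * C.lap (C.ρ (-γ) * g))) := by
    rw [show C.ρ α = C.ρ (α - 4) * (C.ρ 2 * C.ρ 2) by
      rw [C.ρ_mul_ρ rfl, C.ρ_mul_ρ rfl]; congr 1; ring]
    ring
  rw [h4, h1, SphericalCalculus.energy]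
  simp only [spherical_E, spherical_I]
  rw [show C.ρ (-n) = C.ρ (α - 4) * (C.ρ (-γ) * C.ρ (-γ)) by
      rw [C.ρ_mul_ρ rfl, C.ρ_mul_ρ rfl]; congr 1; rw [hγ]; ring]
  congr 1
  ring

lemma I_grad_sq (hγ : γ = (n - 4 + α) / 2) (g : B) :
    C.I (C.ρ (α - 2) * ∑ i, C.P i (C.ρ (-γ) * g) * C.P i (C.ρ (-γ) * g)) =
      C.spherical.dirichlet γ g := by
  have h1 := C.sum_P_mul_P (C.ρ (-γ) * g)
  have h2 : C.ρ (α - 2) = C.ρ (α - 4) * C.ρ 2 := by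
    rw [C.ρ_mul_ρ rfl]; congr 1; ring
  rw [h2, mul_assoc, h1, SphericalCalculus.dirichlet, SphericalCalculus.gradInner]
  simp only [spherical_D, spherical_E, spherical_I]
  rw [show C.ρ (-n) = C.ρ (α - 4) * (C.ρ (-γ) * C.ρ (-γ)) by
      rw [C.ρ_mul_ρ rfl, C.ρ_mul_ρ rfl]; congr 1; rw [hγ]; ring]
  congr 1
  have h3 : ∀ i, C.tang i (C.ρ (-γ) * g) * C.tang i (C.ρ (-γ) * g) =
      C.ρ (-γ) * C.ρ (-γ) * (C.tang i g * C.tang i g) := fun i => by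
    rw [Derivation.leibniz, C.tang_ρ, smul_zero, add_zero, smul_eq_mul]; ring
  simp only [h3, ← Finset.mul_sum]
  simp only [Derivation.leibniz, C.euler_ρ, smul_eq_mul, Algebra.smul_def]
  ring

theorem hardy_rellich (hn : 3 ≤ n) (hδ : δ = (n - α) / 2)
    (h : 0 ≤ (n : ℝ) - 1 + 2 * ((n - 4 + α) / 2) * δ - δ ^ 2) {u : B} (hu : u ∈ C.J) :
    δ ^ 2 * C.I (C.ρ (α - 2) * ∑ i, C.P i u * C.P i u) ≤
      C.I (C.ρ α * (C.lap u * C.lap u)) := by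
  have hg : C.ρ (-((n - 4 + α) / 2)) * (C.ρ ((n - 4 + α) / 2) * u) = u := by
    rw [← mul_assoc, C.ρ_mul_ρ (neg_add_cancel _), C.ρ_zero, one_mul]
  rw [← hg, C.I_lap_sq rfl hδ, C.I_grad_sq rfl]
  exact C.spherical.dirichlet_le_energy hn h (C.J.mul_mem_left _ hu)

end PuncturedCalculus

section PartialDerivative

variable {n : ℕ}

/-- The partial derivative of `f` in the `i`-th coordinate direction. -/
noncomputable def partialDeriv (i : Fin n) (f : EuclideanSpace ℝ (Fin n) → ℝ)
    (x : EuclideanSpace ℝ (Fin n)) : ℝ :=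
  fderiv ℝ f x (EuclideanSpace.single i 1)

lemma ContDiffAt.partialDeriv {k m : WithTop ℕ∞} {f : EuclideanSpace ℝ (Fin n) → ℝ}
    {x : EuclideanSpace ℝ (Fin n)} (hf : ContDiffAt ℝ k f x) (h : m + 1 ≤ k) (i : Fin n) :
    ContDiffAt ℝ m (partialDeriv i f) x :=
  (hf.fderiv_right h).clm_apply contDiffAt_const

lemma ContDiff.partialDeriv {k m : WithTop ℕ∞} {f : EuclideanSpace ℝ (Fin n) → ℝ}
    (hf : ContDiff ℝ k f) (h : m + 1 ≤ k) (i : Fin n) :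
    ContDiff ℝ m (partialDeriv i f) :=
  contDiff_iff_contDiffAt.2 fun _ => hf.contDiffAt.partialDeriv h i

lemma Filter.EventuallyEq.partialDeriv_eq {f g : EuclideanSpace ℝ (Fin n) → ℝ}
    {x : EuclideanSpace ℝ (Fin n)} (h : f =ᶠ[nhds x] g) (i : Fin n) :
    partialDeriv i f x = partialDeriv i g x := by
  rw [partialDeriv, partialDeriv, h.fderiv_eq]

lemma tsupport_partialDeriv_subset (i : Fin n) (f : EuclideanSpace ℝ (Fin n) → ℝ) :
    tsupport (partialDeriv i f) ⊆ tsupport f :=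
  tsupport_fderiv_apply_subset ℝ _

lemma HasCompactSupport.partialDeriv {f : EuclideanSpace ℝ (Fin n) → ℝ}
    (hf : HasCompactSupport f) (i : Fin n) : HasCompactSupport (partialDeriv i f) :=
  hf.fderiv_apply ℝ _

lemma partialDeriv_add {f g : EuclideanSpace ℝ (Fin n) → ℝ} {x : EuclideanSpace ℝ (Fin n)}
    (hf : DifferentiableAt ℝ f x) (hg : DifferentiableAt ℝ g x) (i : Fin n) :
    partialDeriv i (f + g) x = partialDeriv i f x + partialDeriv i g x := by
  simp [partialDeriv, fderiv_add hf hg]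

lemma partialDeriv_mul {f g : EuclideanSpace ℝ (Fin n) → ℝ} {x : EuclideanSpace ℝ (Fin n)}
    (hf : DifferentiableAt ℝ f x) (hg : DifferentiableAt ℝ g x) (i : Fin n) :
    partialDeriv i (f * g) x = f x * partialDeriv i g x + g x * partialDeriv i f x := by
  simp [partialDeriv, fderiv_mul hf hg]

lemma partialDeriv_smul (c : ℝ) (f : EuclideanSpace ℝ (Fin n) → ℝ) (x : EuclideanSpace ℝ (Fin n))
    (i : Fin n) : partialDeriv i (c • f) x = c * partialDeriv i f x := by
  simp [partialDeriv, fderiv_const_smul_field]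

lemma partialDeriv_partialDeriv {f : EuclideanSpace ℝ (Fin n) → ℝ}
    {x : EuclideanSpace ℝ (Fin n)} (hf : ContDiffAt ℝ 2 f x) (i j : Fin n) :
    partialDeriv i (partialDeriv j f) x =
      fderiv ℝ (fderiv ℝ f) x (EuclideanSpace.single i 1) (EuclideanSpace.single j 1) := by
  have h : DifferentiableAt ℝ (fderiv ℝ f) x :=
    (hf.fderiv_right (m := 1) (by norm_num)).differentiableAt (by norm_num)
  unfold partialDeriv
  rw [fderiv_clm_apply h (differentiableAt_const _)]
  simp

lemma partialDeriv_comm {f : EuclideanSpace ℝ (Fin n) → ℝ}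
    {x : EuclideanSpace ℝ (Fin n)} (hf : ContDiffAt ℝ 2 f x) (i j : Fin n) :
    partialDeriv i (partialDeriv j f) x = partialDeriv j (partialDeriv i f) x := by
  rw [partialDeriv_partialDeriv hf, partialDeriv_partialDeriv hf]
  exact hf.isSymmSndFDerivAt (by simp) _ _

lemma partialDeriv_coord (i j : Fin n) (x : EuclideanSpace ℝ (Fin n)) :
    partialDeriv i (fun y => y j) x = if i = j then 1 else 0 := by
  have h : HasFDerivAt (fun y : EuclideanSpace ℝ (Fin n) => y j)
      (EuclideanSpace.proj j : EuclideanSpace ℝ (Fin n) →L[ℝ] ℝ) x :=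
    (EuclideanSpace.proj j : EuclideanSpace ℝ (Fin n) →L[ℝ] ℝ).hasFDerivAt
  rw [partialDeriv, h.fderiv]
  simp [eq_comm]

lemma partialDeriv_norm_rpow (i : Fin n) (a : ℝ) {x : EuclideanSpace ℝ (Fin n)} (hx : x ≠ 0) :
    partialDeriv i (fun y => ‖y‖ ^ a) x = a * (‖x‖ ^ (a - 2) * x i) := by
  have h0 : ‖x‖ ≠ 0 := norm_ne_zero_iff.2 hx
  have h1 := (hasStrictFDerivAt_norm_sq x).hasFDerivAt.rpow_const (p := a / 2)
    (Or.inl (pow_ne_zero 2 h0))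
  have e : ∀ b : ℝ, ∀ y : EuclideanSpace ℝ (Fin n), (‖y‖ ^ 2) ^ b = ‖y‖ ^ (2 * b) := fun b y => by
    rw [Real.rpow_mul (norm_nonneg y), Real.rpow_two]
  have h2 : (fun y : EuclideanSpace ℝ (Fin n) => ‖y‖ ^ a) = fun y => (‖y‖ ^ 2) ^ (a / 2) := by
    funext y
    rw [e]; congr 1; ring
  rw [partialDeriv, h2, h1.fderiv, e, show 2 * (a / 2 - 1) = a - 2 by ring]
  simp [EuclideanSpace.inner_single_right]
  ring

lemma integral_partialDeriv_eq_zero {f : EuclideanSpace ℝ (Fin n) → ℝ} (hf : ContDiff ℝ 1 f)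
    (hc : HasCompactSupport f) (i : Fin n) : ∫ x, partialDeriv i f x = 0 := by
  have hf' : Continuous (partialDeriv i f) := (hf.partialDeriv (m := 0) (by norm_num) i).continuous
  have h := integral_mul_fderiv_eq_neg_fderiv_mul_of_integrable (μ := volume) (f := f)
    (g := fun _ => (1 : ℝ)) (v := EuclideanSpace.single i 1)
    (by simp only [mul_one]; exact hf'.integrable_of_hasCompactSupport (hc.partialDeriv i))
    (by simp) (by simp only [mul_one]; exact hf.continuous.integrable_of_hasCompactSupport hc)
    (fun x _ => hf.differentiable (by norm_num) x) (fun x _ => differentiableAt_const _)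
  simp only [mul_one, fderiv_fun_const, Pi.zero_apply, zero_apply, mul_zero,
    integral_zero, zero_eq_neg] at h
  exact h

end PartialDerivative

section Model

variable {n : ℕ}

/-- Functions smooth away from the origin. Their value at the origin carries no information and is
normalized to agree with the value at `p`. -/
def smoothAway (p : EuclideanSpace ℝ (Fin n)) : Subalgebra ℝ (EuclideanSpace ℝ (Fin n) → ℝ) where
  carrier := {f | (∀ x, x ≠ 0 → ContDiffAt ℝ (⊤ : ℕ∞) f x) ∧ f 0 = f p}
  mul_mem' hf hg := ⟨fun x hx => (hf.1 x hx).mul (hg.1 x hx), by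
    simp only [Pi.mul_apply, hf.2, hg.2]⟩
  add_mem' hf hg := ⟨fun x hx => (hf.1 x hx).add (hg.1 x hx), by
    simp only [Pi.add_apply, hf.2, hg.2]⟩
  algebraMap_mem' c := ⟨fun _ _ => contDiffAt_const, rfl⟩

open Classical in
/-- Replace the value at the origin by the value at `p`. -/
noncomputable def moveOrigin (p x : EuclideanSpace ℝ (Fin n)) : EuclideanSpace ℝ (Fin n) :=
  if x = 0 then p else x

variable {p : EuclideanSpace ℝ (Fin n)}

lemma moveOrigin_of_ne {x : EuclideanSpace ℝ (Fin n)} (hx : x ≠ 0) : moveOrigin p x = x := if_neg hx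

lemma moveOrigin_ne_zero (hp : p ≠ 0) (x : EuclideanSpace ℝ (Fin n)) : moveOrigin p x ≠ 0 := by
  unfold moveOrigin; split_ifs <;> assumption

lemma comp_moveOrigin_eventuallyEq (f : EuclideanSpace ℝ (Fin n) → ℝ)
    {x : EuclideanSpace ℝ (Fin n)} (hx : x ≠ 0) : (fun y => f (moveOrigin p y)) =ᶠ[nhds x] f := by
  filter_upwards [isOpen_ne.mem_nhds hx] with y hy
  rw [moveOrigin_of_ne hy]

lemma apply_moveOrigin (f : smoothAway p) (x : EuclideanSpace ℝ (Fin n)) :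
    f.1 (moveOrigin p x) = f.1 x := by
  unfold moveOrigin
  split_ifs with h
  · rw [h, f.2.2]
  · rfl

/-- Restrict a function smooth on the punctured space. -/
noncomputable def mkAway (hp : p ≠ 0) (f : EuclideanSpace ℝ (Fin n) → ℝ)
    (hf : ∀ x, x ≠ 0 → ContDiffAt ℝ (⊤ : ℕ∞) f x) : smoothAway p :=
  ⟨fun x => f (moveOrigin p x),
    fun x hx => (hf x hx).congr_of_eventuallyEq (comp_moveOrigin_eventuallyEq f hx),
    by simp [moveOrigin, hp]⟩

lemma mkAway_apply (hp : p ≠ 0) (f : EuclideanSpace ℝ (Fin n) → ℝ)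
    (hf : ∀ x, x ≠ 0 → ContDiffAt ℝ (⊤ : ℕ∞) f x) (x : EuclideanSpace ℝ (Fin n)) :
    (mkAway hp f hf).1 x = f (moveOrigin p x) := rfl

lemma mkAway_eventuallyEq (hp : p ≠ 0) (f : EuclideanSpace ℝ (Fin n) → ℝ)
    (hf : ∀ x, x ≠ 0 → ContDiffAt ℝ (⊤ : ℕ∞) f x) {x : EuclideanSpace ℝ (Fin n)} (hx : x ≠ 0) :
    (mkAway hp f hf).1 =ᶠ[nhds x] f :=
  comp_moveOrigin_eventuallyEq f hx

lemma partialDeriv_mkAway (hp : p ≠ 0) (i : Fin n) (f : EuclideanSpace ℝ (Fin n) → ℝ)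
    (hf : ∀ x, x ≠ 0 → ContDiffAt ℝ (⊤ : ℕ∞) f x) (x : EuclideanSpace ℝ (Fin n)) :
    partialDeriv i (mkAway hp f hf).1 (moveOrigin p x) = partialDeriv i f (moveOrigin p x) :=
  (mkAway_eventuallyEq hp f hf (moveOrigin_ne_zero hp x)).partialDeriv_eq i

/-- The coordinate functions. -/
noncomputable def coordAway (hp : p ≠ 0) (j : Fin n) : smoothAway p :=
  mkAway hp (fun x => x j) fun x _ => by
    have h : ContDiff ℝ (⊤ : ℕ∞) fun x : EuclideanSpace ℝ (Fin n) => x j := by fun_prop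
    exact h.contDiffAt

/-- The powers of the radius. -/
noncomputable def radiusAway (hp : p ≠ 0) (a : ℝ) : smoothAway p :=
  mkAway hp (fun x => ‖x‖ ^ a) fun _ hx =>
    (contDiffAt_norm ℝ hx).rpow_const_of_ne (norm_ne_zero_iff.2 hx)

lemma smoothAway_differentiableAt (f : smoothAway p) {x : EuclideanSpace ℝ (Fin n)}
    (hx : x ≠ 0) : DifferentiableAt ℝ f.1 x :=
  (f.2.1 x hx).differentiableAt (by norm_num)

lemma smoothAway_contDiffAt_partialDeriv (i : Fin n) (f : smoothAway p) (x : EuclideanSpace ℝ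
    (Fin n))
    (hx : x ≠ 0) : ContDiffAt ℝ (⊤ : ℕ∞) (partialDeriv i f.1) x :=
  (f.2.1 x hx).partialDeriv (by simp) i

/-- The partial derivatives as derivations. -/
noncomputable def partialAway (hp : p ≠ 0) (i : Fin n) :
    Derivation ℝ (smoothAway p) (smoothAway p) :=
  Derivation.mk'
    { toFun := fun f => mkAway hp (partialDeriv i f.1) (smoothAway_contDiffAt_partialDeriv i f)
      map_add' := fun f g => Subtype.ext <| funext fun x =>
        partialDeriv_add (smoothAway_differentiableAt f (moveOrigin_ne_zero hp x))
          (smoothAway_differentiableAt g (moveOrigin_ne_zero hp x)) i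
      map_smul' := fun c f => Subtype.ext <| funext fun x => partialDeriv_smul c f.1 _ i }
    fun f g => Subtype.ext <| funext fun x => by
      have h := partialDeriv_mul (smoothAway_differentiableAt f (moveOrigin_ne_zero hp x))
          (smoothAway_differentiableAt g (moveOrigin_ne_zero hp x)) i
      rw [apply_moveOrigin, apply_moveOrigin] at h
      exact h

lemma partialAway_apply (hp : p ≠ 0) (i : Fin n) (f : smoothAway p)
    (x : EuclideanSpace ℝ (Fin n)) :
    (partialAway hp i f).1 x = partialDeriv i f.1 (moveOrigin p x) := rfl

/-- Functions compactly supported away from the origin and from `p`. -/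
def compactAway (p : EuclideanSpace ℝ (Fin n)) : Ideal (smoothAway p) where
  carrier := {f | HasCompactSupport f.1 ∧ 0 ∉ tsupport f.1 ∧ p ∉ tsupport f.1}
  add_mem' {f g} hf hg := ⟨hf.1.add hg.1,
    fun h => (tsupport_add f.1 g.1 h).elim hf.2.1 hg.2.1,
    fun h => (tsupport_add f.1 g.1 h).elim hf.2.2 hg.2.2⟩
  zero_mem' := ⟨HasCompactSupport.zero, by simp [tsupport], by simp [tsupport]⟩
  smul_mem' c f hf := ⟨hf.1.mul_left,
    fun h => hf.2.1 (tsupport_mul_subset_right (f := c.1) (g := f.1) h),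
    fun h => hf.2.2 (tsupport_mul_subset_right (f := c.1) (g := f.1) h)⟩

lemma contDiff_of_mem_compactAway {f : smoothAway p} (hf : f ∈ compactAway p) :
    ContDiff ℝ (⊤ : ℕ∞) f.1 := contDiff_iff_contDiffAt.2 fun x => by
  by_cases hx : x = 0
  · rw [hx]
    exact contDiffAt_const.congr_of_eventuallyEq (notMem_tsupport_iff_eventuallyEq.1 hf.2.1)
  · exact f.2.1 x hx

lemma partialAway_of_mem (hp : p ≠ 0) (i : Fin n) {f : smoothAway p} (hf : f ∈ compactAway p) :
    (partialAway hp i f).1 = partialDeriv i f.1 := by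
  funext x
  by_cases hx : x = 0
  · rw [partialAway_apply, moveOrigin, if_pos hx, hx,
      image_eq_zero_of_notMem_tsupport fun h => hf.2.1 (tsupport_partialDeriv_subset i f.1 h),
      image_eq_zero_of_notMem_tsupport fun h => hf.2.2 (tsupport_partialDeriv_subset i f.1 h)]
  · rw [partialAway_apply, moveOrigin_of_ne hx]

lemma partialAway_mem (hp : p ≠ 0) (i : Fin n) {f : smoothAway p} (hf : f ∈ compactAway p) :
    partialAway hp i f ∈ compactAway p := by
  change HasCompactSupport _ ∧ _ ∧ _
  rw [partialAway_of_mem hp i hf]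
  exact ⟨hf.1.partialDeriv i, fun h => hf.2.1 (tsupport_partialDeriv_subset i f.1 h),
    fun h => hf.2.2 (tsupport_partialDeriv_subset i f.1 h)⟩

lemma integrable_of_mem_compactAway {f : smoothAway p} (hf : f ∈ compactAway p) :
    Integrable f.1 :=
  (contDiff_of_mem_compactAway hf).continuous.integrable_of_hasCompactSupport hf.1

lemma exists_integral_compactAway (p : EuclideanSpace ℝ (Fin n)) :
    ∃ I : smoothAway p →ₗ[ℝ] ℝ, ∀ f ∈ compactAway p, I f = ∫ x, f.1 x := by
  let I₀ : (compactAway p).restrictScalars ℝ →ₗ[ℝ] ℝ :=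
    { toFun := fun f => ∫ x, f.1.1 x
      map_add' := fun f g => integral_add (integrable_of_mem_compactAway f.2)
        (integrable_of_mem_compactAway g.2)
      map_smul' := fun c f => integral_const_mul c _ }
  obtain ⟨I, hI⟩ := LinearMap.exists_extend I₀
  exact ⟨I, fun f hf => LinearMap.congr_fun hI ⟨f, hf⟩⟩

/-- The calculus of functions smooth away from the origin. -/
noncomputable def puncturedCalculus (hp : p ≠ 0) : PuncturedCalculus n (smoothAway p) where
  P := partialAway hp
  X := coordAway hp
  ρ := radiusAway hp
  J := compactAway p
  I := (exists_integral_compactAway p).choose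
  P_comm i j f := Subtype.ext <| funext fun x =>
    (partialDeriv_mkAway hp i _ (smoothAway_contDiffAt_partialDeriv j f) x).trans <|
      (partialDeriv_comm ((f.2.1 _ (moveOrigin_ne_zero hp x)).of_le
        (WithTop.coe_le_coe.2 (le_top (a := (2 : ℕ∞))))) i j).trans
      (partialDeriv_mkAway hp j _ (smoothAway_contDiffAt_partialDeriv i f) x).symm
  P_X i j := Subtype.ext <| funext fun x => by
    rw [partialAway_apply, coordAway, partialDeriv_mkAway, partialDeriv_coord]
    split_ifs <;> rfl
  ρ_zero := Subtype.ext <| funext fun x => Real.rpow_zero _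
  ρ_add a b := Subtype.ext <| funext fun x =>
    Real.rpow_add (norm_pos_iff.2 (moveOrigin_ne_zero hp x)) a b
  ρ_two := Subtype.ext <| funext fun x => by
    rw [radiusAway, mkAway_apply, Real.rpow_two, EuclideanSpace.norm_sq_eq]
    simp [mkAway_apply, coordAway, sq]
  P_ρ i a := Subtype.ext <| funext fun x => by
    rw [partialAway_apply, radiusAway, partialDeriv_mkAway,
      partialDeriv_norm_rpow i a (moveOrigin_ne_zero hp x)]
    rfl
  P_mem i {f} hf := partialAway_mem hp i hf
  I_P i {f} hf := by
    rw [(exists_integral_compactAway p).choose_spec _ (partialAway_mem hp i hf),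
      partialAway_of_mem hp i hf]
    exact integral_partialDeriv_eq_zero
      ((contDiff_of_mem_compactAway hf).of_le (by exact_mod_cast le_top)) hf.1 i
  I_mul_self_nonneg {f} hf := by
    rw [(exists_integral_compactAway p).choose_spec _ (Ideal.mul_mem_left _ _ hf)]
    exact integral_nonneg fun x => mul_self_nonneg (f.1 x)

end Model

section SmoothInequality

variable {n : ℕ} {p : EuclideanSpace ℝ (Fin n)}

lemma puncturedCalculus_I (hp : p ≠ 0) {f : smoothAway p} (hf : f ∈ compactAway p) :
    (puncturedCalculus hp).I f = ∫ x, f.1 x :=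
  (exists_integral_compactAway p).choose_spec f hf

lemma radiusAway_mul_apply (hp : p ≠ 0) (a : ℝ) {f : smoothAway p} (hf : f ∈ compactAway p)
    (x : EuclideanSpace ℝ (Fin n)) : (radiusAway hp a * f).1 x = ‖x‖ ^ a * f.1 x := by
  by_cases hx : x = 0
  · have h0 : f.1 x = 0 := by rw [hx]; exact image_eq_zero_of_notMem_tsupport hf.2.1
    change _ * f.1 x = _
    rw [h0, mul_zero, mul_zero]
  · change ‖moveOrigin p x‖ ^ a * f.1 x = _
    rw [moveOrigin_of_ne hx]

lemma puncturedCalculus_I_ρ_mul (hp : p ≠ 0) (a : ℝ) {f : smoothAway p} (hf : f ∈ compactAway p) :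
    (puncturedCalculus hp).I ((puncturedCalculus hp).ρ a * f) = ∫ x, ‖x‖ ^ a * f.1 x := by
  rw [puncturedCalculus_I hp (Ideal.mul_mem_left _ _ hf)]
  exact integral_congr_ae (.of_forall fun x => radiusAway_mul_apply hp a hf x)

lemma smoothAway_sum_apply (f : Fin n → smoothAway p) (x : EuclideanSpace ℝ (Fin n)) :
    (∑ i, f i).1 x = ∑ i, (f i).1 x := by
  have h : (∑ i, f i).1 = ∑ i, (f i).1 := map_sum (smoothAway p).val f Finset.univ
  rw [h, Finset.sum_apply]

lemma puncturedCalculus_lap_apply (hp : p ≠ 0) {f : smoothAway p} (hf : f ∈ compactAway p)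
    (x : EuclideanSpace ℝ (Fin n)) :
    ((puncturedCalculus hp).lap f).1 x = ∑ i, partialDeriv i (partialDeriv i f.1) x := by
  rw [PuncturedCalculus.lap, smoothAway_sum_apply]
  refine Finset.sum_congr rfl fun i _ => ?_
  rw [← partialAway_of_mem hp i hf, ← partialAway_of_mem hp i (partialAway_mem hp i hf)]
  rfl

lemma puncturedCalculus_I_lap_sq (hp : p ≠ 0) (a : ℝ) {f : smoothAway p}
    (hf : f ∈ compactAway p) :
    (puncturedCalculus hp).I ((puncturedCalculus hp).ρ a *
        ((puncturedCalculus hp).lap f * (puncturedCalculus hp).lap f)) =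
      ∫ x, ‖x‖ ^ a * (∑ i, partialDeriv i (partialDeriv i f.1) x) ^ 2 := by
  have hl : (puncturedCalculus hp).lap f ∈ compactAway p :=
    Ideal.sum_mem _ fun i _ => partialAway_mem hp i (partialAway_mem hp i hf)
  rw [puncturedCalculus_I_ρ_mul hp a (Ideal.mul_mem_left _ _ hl)]
  refine integral_congr_ae (.of_forall fun x => ?_)
  change _ * (((puncturedCalculus hp).lap f).1 x * ((puncturedCalculus hp).lap f).1 x) = _
  rw [puncturedCalculus_lap_apply hp hf, ← sq]

lemma puncturedCalculus_I_grad_sq (hp : p ≠ 0) (a : ℝ) {f : smoothAway p}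
    (hf : f ∈ compactAway p) :
    (puncturedCalculus hp).I ((puncturedCalculus hp).ρ a *
        ∑ i, (puncturedCalculus hp).P i f * (puncturedCalculus hp).P i f) =
      ∫ x, ‖x‖ ^ a * ∑ i, partialDeriv i f.1 x ^ 2 := by
  have hg : ∑ i, (puncturedCalculus hp).P i f * (puncturedCalculus hp).P i f ∈ compactAway p :=
    Ideal.sum_mem _ fun i _ => Ideal.mul_mem_left _ _ (partialAway_mem hp i hf)
  rw [puncturedCalculus_I_ρ_mul hp a hg]
  refine integral_congr_ae (.of_forall fun x => ?_)
  dsimp only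
  rw [smoothAway_sum_apply]
  congr 1
  refine Finset.sum_congr rfl fun i _ => ?_
  rw [← partialAway_of_mem hp i hf, sq]
  rfl

theorem hardy_rellich_of_smooth (hn : 3 ≤ n) {α δ : ℝ} (hδ : δ = (n - α) / 2)
    (h : 0 ≤ (n : ℝ) - 1 + 2 * ((n - 4 + α) / 2) * δ - δ ^ 2)
    {u : EuclideanSpace ℝ (Fin n) → ℝ} (hu : ContDiff ℝ (⊤ : ℕ∞) u) (hc : HasCompactSupport u)
    (h0 : (0 : EuclideanSpace ℝ (Fin n)) ∉ tsupport u) :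
    δ ^ 2 * ∫ x, ‖x‖ ^ (α - 2) * ∑ i, partialDeriv i u x ^ 2 ≤
      ∫ x, ‖x‖ ^ α * (∑ i, partialDeriv i (partialDeriv i u) x) ^ 2 := by
  have : Nonempty (Fin n) := ⟨⟨0, by omega⟩⟩
  obtain ⟨p, hp⟩ := (Set.ne_univ_iff_exists_notMem _).1
    ((hc.isCompact.union (isCompact_singleton (x := (0 : EuclideanSpace ℝ (Fin n))))).ne_univ)
  have hp0 : p ≠ 0 := fun h => hp (Or.inr h)
  have hpu : p ∉ tsupport u := fun h => hp (Or.inl h)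
  let f : smoothAway p := ⟨u, fun x _ => hu.contDiffAt, by
    rw [image_eq_zero_of_notMem_tsupport h0, image_eq_zero_of_notMem_tsupport hpu]⟩
  have hf : f ∈ compactAway p := ⟨hc, h0, hpu⟩
  have key := (puncturedCalculus hp0).hardy_rellich hn hδ h hf
  rwa [puncturedCalculus_I_lap_sq hp0 _ hf, puncturedCalculus_I_grad_sq hp0 _ hf] at key

end SmoothInequality

section Sharpness

lemma integral_norm_rpow_mul_comp_rpow {n : ℕ} (hn : 0 < n) (k : ℝ → ℝ) {ε : ℝ} (hε : 0 < ε) :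
    ∫ x : EuclideanSpace ℝ (Fin n), ‖x‖ ^ (-n : ℝ) * k (‖x‖ ^ ε) =
      ε⁻¹ * ∫ x : EuclideanSpace ℝ (Fin n), ‖x‖ ^ (-n : ℝ) * k ‖x‖ := by
  have : Nonempty (Fin n) := ⟨⟨0, hn⟩⟩
  have e : ∀ y : ℝ, y ∈ Set.Ioi 0 → ∀ z : ℝ, y ^ (n - 1) • (y ^ (-n : ℝ) * z) = y⁻¹ * z :=
    fun y hy z => by
      have hy0 : y ≠ 0 := (Set.mem_Ioi.1 hy).ne'
      rw [Real.rpow_neg (le_of_lt hy), Real.rpow_natCast, smul_eq_mul]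
      obtain ⟨m, rfl⟩ : ∃ m, n = m + 1 := ⟨n - 1, by omega⟩
      field_simp
      simp
      ring
  rw [integral_fun_norm_addHaar volume fun y => y ^ (-n : ℝ) * k (y ^ ε),
    integral_fun_norm_addHaar volume fun y => y ^ (-n : ℝ) * k y, finrank_euclideanSpace_fin,
    setIntegral_congr_fun measurableSet_Ioi fun y hy => e y hy _,
    setIntegral_congr_fun measurableSet_Ioi fun y hy => e y hy _,
    ← integral_comp_rpow_Ioi (fun t => t⁻¹ * k t) hε.ne']
  have e2 : ∀ y : ℝ, y ∈ Set.Ioi 0 → (|ε| * y ^ (ε - 1)) • ((y ^ ε)⁻¹ * k (y ^ ε)) =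
      ε * (y⁻¹ * k (y ^ ε)) := fun y hy => by
    have hy0 : y ^ ε ≠ 0 := (Real.rpow_pos_of_pos hy ε).ne'
    have hy1 : y ≠ 0 := (Set.mem_Ioi.1 hy).ne'
    rw [abs_of_pos hε, Real.rpow_sub_one hy1, smul_eq_mul]
    field_simp
  rw [setIntegral_congr_fun measurableSet_Ioi e2, integral_const_mul]
  simp only [smul_eq_mul, nsmul_eq_mul]
  field_simp

/-- Smooth functions of one variable supported in `[3 / 2, 5 / 2]`. -/
def IsProfile (ψ : ℝ → ℝ) : Prop :=
  ContDiff ℝ (⊤ : ℕ∞) ψ ∧ tsupport ψ ⊆ Set.Icc (3 / 2) (5 / 2)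

lemma IsProfile.mul_deriv {ψ : ℝ → ℝ} (h : IsProfile ψ) : IsProfile fun t => t * deriv ψ t :=
  ⟨contDiff_id.mul (h.1.deriv' ), (tsupport_mul_subset_right.trans
    (tsupport_deriv_subset)).trans h.2⟩

lemma exists_isProfile : ∃ ψ, IsProfile ψ ∧ ψ 2 ≠ 0 := by
  obtain ⟨ψ, h1, -, h3, -, h5⟩ := exists_contDiff_tsupport_subset (n := ⊤)
    (Icc_mem_nhds (show (3 / 2 : ℝ) < 2 by norm_num) (show (2 : ℝ) < 5 / 2 by norm_num))
  exact ⟨ψ, ⟨h3, h1⟩, by rw [h5]; exact one_ne_zero⟩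

variable {n : ℕ} {p : EuclideanSpace ℝ (Fin n)}

/-- The radial function with profile `ψ` in the variable `‖x‖ ^ ε`. -/
noncomputable def radialAway (hp : p ≠ 0) (ε : ℝ) {ψ : ℝ → ℝ} (hψ : IsProfile ψ) : smoothAway p :=
  mkAway hp (fun x => ψ (‖x‖ ^ ε)) fun _ hx => hψ.1.contDiffAt.comp _
    ((contDiffAt_norm ℝ hx).rpow_const_of_ne (norm_ne_zero_iff.2 hx))

variable {ε : ℝ} {ψ : ℝ → ℝ}

lemma IsProfile.eq_zero (hψ : IsProfile ψ) {t : ℝ} (ht : t < 3 / 2) : ψ t = 0 :=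
  image_eq_zero_of_notMem_tsupport fun h => absurd (hψ.2 h).1 (not_le.2 ht)

lemma radialAway_apply (hp : ‖p‖ = 1) (hp0 : p ≠ 0) (hε : 0 < ε) (hψ : IsProfile ψ)
    (x : EuclideanSpace ℝ (Fin n)) : (radialAway hp0 ε hψ).1 x = ψ (‖x‖ ^ ε) := by
  by_cases hx : x = 0
  · rw [radialAway, mkAway_apply, moveOrigin, if_pos hx, hp, hx, norm_zero, Real.zero_rpow hε.ne',
      Real.one_rpow, hψ.eq_zero (by norm_num), hψ.eq_zero (by norm_num)]
  · rw [radialAway, mkAway_apply, moveOrigin_of_ne hx]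

lemma radialAway_mem (hp : ‖p‖ = 1) (hp0 : p ≠ 0) (hε : 0 < ε) (hψ : IsProfile ψ) :
    radialAway hp0 ε hψ ∈ compactAway p := by
  have hcont : Continuous fun x : EuclideanSpace ℝ (Fin n) => ‖x‖ ^ ε :=
    continuous_norm.rpow_const fun _ => Or.inr hε.le
  have hsub : tsupport (radialAway hp0 ε hψ).1 ⊆
      (fun x : EuclideanSpace ℝ (Fin n) => ‖x‖ ^ ε) ⁻¹' Set.Icc (3 / 2) (5 / 2) := by
    refine closure_minimal (fun x hx => hψ.2 ?_) (isClosed_Icc.preimage hcont)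
    rw [Function.mem_support, radialAway_apply hp hp0 hε] at hx
    exact subset_tsupport _ hx
  refine ⟨HasCompactSupport.of_support_subset_isCompact
    (isCompact_closedBall (0 : EuclideanSpace ℝ (Fin n)) ((5 / 2) ^ ε⁻¹)) fun x hx => ?_,
    fun h => ?_, fun h => ?_⟩
  · have h2 := (hsub (subset_tsupport _ hx)).2
    rw [mem_closedBall_zero_iff]
    calc ‖x‖ = (‖x‖ ^ ε) ^ ε⁻¹ := by
          rw [← Real.rpow_mul (norm_nonneg x), mul_inv_cancel₀ hε.ne', Real.rpow_one]
      _ ≤ _ := Real.rpow_le_rpow (by positivity) h2 (by positivity)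
  · have h2 := (hsub h).1
    norm_num [Real.zero_rpow hε.ne'] at h2
  · have h2 := (hsub h).1
    norm_num [hp] at h2

lemma partialAway_radialAway (hp0 : p ≠ 0) (hψ : IsProfile ψ) (i : Fin n) :
    partialAway hp0 i (radialAway hp0 ε hψ) = coordAway hp0 i *
      (ε • (radiusAway hp0 (-2) * radialAway hp0 ε hψ.mul_deriv)) := by
  refine Subtype.ext <| funext fun x => ?_
  have hx := moveOrigin_ne_zero hp0 x
  have hx' := norm_ne_zero_iff.2 hx
  have hd : DifferentiableAt ℝ (fun y : EuclideanSpace ℝ (Fin n) => ‖y‖ ^ ε) (moveOrigin p x) :=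
    ((contDiffAt_norm ℝ hx).rpow_const_of_ne (n := 1) hx').differentiableAt (by norm_num)
  have h1 := (hψ.1.differentiable (by simp) (‖moveOrigin p x‖ ^ ε)).hasDerivAt.comp_hasFDerivAt
    (moveOrigin p x) hd.hasFDerivAt
  have h2 := partialDeriv_norm_rpow i ε hx
  rw [partialAway_apply, radialAway, partialDeriv_mkAway, partialDeriv]
  change fderiv ℝ (ψ ∘ fun y => ‖y‖ ^ ε) _ _ = (moveOrigin p x) i * (ε * (‖moveOrigin p x‖ ^ (-2
      : ℝ) *
    (‖moveOrigin p x‖ ^ ε * deriv ψ (‖moveOrigin p x‖ ^ ε))))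
  rw [h1.fderiv, smul_apply, ← partialDeriv, h2,
    show ε - 2 = ε + -2 by ring, Real.rpow_add (norm_pos_iff.2 hx), smul_eq_mul]
  ring

end Sharpness

namespace PuncturedCalculus

variable {n : ℕ} {B : Type*} [CommRing B] [Algebra ℝ B] (C : PuncturedCalculus n B)

lemma euler_of_radial {g h : B} (hg : ∀ i, C.P i g = C.X i * h) : C.euler g = C.ρ 2 * h := by
  rw [C.euler_apply, C.ρ_two, Finset.sum_mul]
  exact Finset.sum_congr rfl fun i _ => by rw [hg]; ring

lemma tang_of_radial {g h : B} (hg : ∀ i, C.P i g = C.X i * h) (i : Fin n) : C.tang i g = 0 := by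
  rw [C.tang_apply, C.euler_of_radial hg, hg, ← C.ρ_mul_ρ (show (1 + 1 : ℝ) = 2 by norm_num),
    ← C.ρ_one_mul_ν i]
  ring

end PuncturedCalculus

section Sharpness

variable {n : ℕ} {p : EuclideanSpace ℝ (Fin n)} {ε : ℝ} {ψ : ℝ → ℝ}

lemma euler_radialAway (hp : p ≠ 0) (hψ : IsProfile ψ) :
    (puncturedCalculus hp).euler (radialAway hp ε hψ) = ε • radialAway hp ε hψ.mul_deriv := by
  rw [(puncturedCalculus hp).euler_of_radial (partialAway_radialAway hp hψ)]
  change radiusAway hp 2 * _ = _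
  rw [mul_smul_comm, ← mul_assoc]
  have h : radiusAway hp 2 * radiusAway hp (-2) = 1 := by
    rw [← (puncturedCalculus hp).ρ_zero]
    exact (puncturedCalculus hp).ρ_mul_ρ (by norm_num)
  rw [h, one_mul]

lemma tang_radialAway (hp : p ≠ 0) (hψ : IsProfile ψ) (i : Fin n) :
    (puncturedCalculus hp).tang i (radialAway hp ε hψ) = 0 :=
  (puncturedCalculus hp).tang_of_radial (partialAway_radialAway hp hψ) i

/-- The squared norm of the radial function with profile `ψ` with respect to the scale invariant
measure. -/
noncomputable def profileMass (n : ℕ) (ψ : ℝ → ℝ) : ℝ :=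
  ∫ x : EuclideanSpace ℝ (Fin n), ‖x‖ ^ (-n : ℝ) * ψ ‖x‖ ^ 2

lemma spherical_I_radialAway (hn : 0 < n) (hp : ‖p‖ = 1) (hp0 : p ≠ 0) (hε : 0 < ε)
    (hψ : IsProfile ψ) :
    (puncturedCalculus hp0).spherical.I (radialAway hp0 ε hψ * radialAway hp0 ε hψ) =
      ε⁻¹ * profileMass n ψ := by
  rw [profileMass, ← integral_norm_rpow_mul_comp_rpow hn (fun t => ψ t ^ 2) hε,
    PuncturedCalculus.spherical_I,
    puncturedCalculus_I_ρ_mul hp0 _ (Ideal.mul_mem_left _ _ (radialAway_mem hp hp0 hε hψ))]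
  refine integral_congr_ae (.of_forall fun x => ?_)
  change _ * ((radialAway hp0 ε hψ).1 x * (radialAway hp0 ε hψ).1 x) = _
  rw [radialAway_apply hp hp0 hε, ← sq]

lemma profileMass_pos (hn : 0 < n) (hψ : IsProfile ψ) (h2 : ψ 2 ≠ 0) : 0 < profileMass n ψ := by
  let e : EuclideanSpace ℝ (Fin n) := EuclideanSpace.single ⟨0, hn⟩ 1
  have he : ‖e‖ = 1 := by simp [e]
  have he0 : e ≠ 0 := norm_ne_zero_iff.1 (by rw [he]; exact one_ne_zero)
  have hm := radialAway_mem he he0 one_pos hψ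
  have hm2 : radiusAway he0 (-n) * (radialAway he0 1 hψ * radialAway he0 1 hψ) ∈ compactAway e :=
    Ideal.mul_mem_left _ _ (Ideal.mul_mem_left _ _ hm)
  have hx : ∀ x, (radiusAway he0 (-n) * (radialAway he0 1 hψ * radialAway he0 1 hψ)).1 x =
      ‖x‖ ^ (-n : ℝ) * ψ ‖x‖ ^ 2 := fun x => by
    rw [radiusAway_mul_apply he0 _ (Ideal.mul_mem_left _ _ hm)]
    change _ * ((radialAway he0 1 hψ).1 x * (radialAway he0 1 hψ).1 x) = _
    rw [radialAway_apply he he0 one_pos, Real.rpow_one, sq]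
  rw [profileMass, ← integral_congr_ae (.of_forall hx)]
  refine (contDiff_of_mem_compactAway
      hm2).continuous.integral_pos_of_hasCompactSupport_nonneg_nonzero
    hm2.1 (fun x => ?_) (x := (2 : ℝ) • e) ?_
  · rw [hx]; exact mul_nonneg (Real.rpow_nonneg (norm_nonneg _) _) (sq_nonneg _)
  · rw [hx, norm_smul, he]
    norm_num
    exact h2

theorem exists_lt_mul_of_sq_lt (hn : 0 < n) {α c : ℝ} (hα : α ≠ 4 - n)
    (hc : ((n - α) / 2) ^ 2 < c) :
    ∃ u : EuclideanSpace ℝ (Fin n) → ℝ, ContDiff ℝ (⊤ : ℕ∞) u ∧ HasCompactSupport u ∧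
      0 ∉ tsupport u ∧ 0 < ∫ x, ‖x‖ ^ (α - 2) * ∑ i, partialDeriv i u x ^ 2 ∧
      ∫ x, ‖x‖ ^ α * (∑ i, partialDeriv i (partialDeriv i u) x) ^ 2 <
        c * ∫ x, ‖x‖ ^ (α - 2) * ∑ i, partialDeriv i u x ^ 2 := by
  obtain ⟨ψ, hψ, hψ2⟩ := exists_isProfile
  let p : EuclideanSpace ℝ (Fin n) := EuclideanSpace.single ⟨0, hn⟩ 1
  have hp : ‖p‖ = 1 := by simp [p]
  have hp0 : p ≠ 0 := norm_ne_zero_iff.1 (by rw [hp]; exact one_ne_zero)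
  set γ : ℝ := (n - 4 + α) / 2 with hγ
  set δ : ℝ := (n - α) / 2 with hδ
  have hγ0 : γ ≠ 0 := fun h => hα (by rw [hγ] at h; linarith)
  have hm : 0 < γ ^ 2 * profileMass n ψ := by have := profileMass_pos hn hψ hψ2; positivity
  obtain ⟨ε, hε, hlt⟩ : ∃ ε : ℝ, 0 < ε ∧
      ε ^ 4 * profileMass n (fun t => t * deriv (fun t => t * deriv ψ t) t) +
        γ ^ 2 * (ε ^ 2 * profileMass n fun t => t * deriv ψ t) <
        (c - δ ^ 2) * (γ ^ 2 * profileMass n ψ) := by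
    have hcont : Continuous fun ε : ℝ =>
        ε ^ 4 * profileMass n (fun t => t * deriv (fun t => t * deriv ψ t) t) +
          γ ^ 2 * (ε ^ 2 * profileMass n fun t => t * deriv ψ t) := by fun_prop
    have h := (hcont.tendsto 0).eventually_lt_const
      (u := (c - δ ^ 2) * (γ ^ 2 * profileMass n ψ))
      (by norm_num; exact mul_pos (sub_pos.2 hc) hm)
    obtain ⟨ε, h1, h2⟩ := ((h.filter_mono nhdsWithin_le_nhds).and
      (self_mem_nhdsWithin (s := Set.Ioi (0 : ℝ)))).exists
    exact ⟨ε, h2, h1⟩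
  set C := puncturedCalculus hp0
  let g := radialAway hp0 ε hψ
  have hg : g ∈ compactAway p := radialAway_mem hp hp0 hε hψ
  have hf : C.ρ (-γ) * g ∈ compactAway p := Ideal.mul_mem_left _ _ hg
  have hE : C.spherical.E g = ε • radialAway hp0 ε hψ.mul_deriv := euler_radialAway hp0 hψ
  have hEE : C.spherical.E (C.spherical.E g) =
      ε • ε • radialAway hp0 ε hψ.mul_deriv.mul_deriv := by
    rw [hE, Derivation.map_smul, C.spherical_E, euler_radialAway]
  have hD : ∀ i, C.spherical.D i g = 0 := tang_radialAway hp0 hψ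
  have hgrad : C.spherical.gradInner g g = 0 := by simp [SphericalCalculus.gradInner, hD]
  have hdir : C.spherical.dirichlet γ g =
      ε ^ 2 * (ε⁻¹ * profileMass n fun t => t * deriv ψ t) + γ ^ 2 * (ε⁻¹ * profileMass n ψ) := by
    rw [C.spherical.dirichlet_eq γ hg, hgrad, hE, smul_mul_smul_comm, map_smul, map_zero,
      spherical_I_radialAway hn hp hp0 hε, spherical_I_radialAway hn hp hp0 hε, smul_eq_mul, ← sq,
      add_zero]
  have hen := C.spherical.energy_eq_of_radial γ δ hg hD
  rw [hEE, hE] at hen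
  simp only [smul_mul_smul_comm, map_smul, smul_eq_mul] at hen
  rw [spherical_I_radialAway hn hp hp0 hε, spherical_I_radialAway hn hp hp0 hε] at hen
  have hm1 : 0 ≤ profileMass n fun t => t * deriv ψ t :=
    integral_nonneg fun x => mul_nonneg (Real.rpow_nonneg (norm_nonneg _) _) (sq_nonneg _)
  rw [← C.I_lap_sq hγ hδ, puncturedCalculus_I_lap_sq hp0 _ hf] at hen
  rw [← C.I_grad_sq hγ, puncturedCalculus_I_grad_sq hp0 _ hf] at hdir
  rw [← C.I_grad_sq hγ, puncturedCalculus_I_grad_sq hp0 _ hf] at hen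
  have hε' : 0 < ε⁻¹ := inv_pos.2 hε
  refine ⟨(C.ρ (-γ) * g).1, contDiff_of_mem_compactAway hf, hf.1, hf.2.1, ?_, ?_⟩
  · rw [hdir]
    have : 0 < ε⁻¹ * (γ ^ 2 * profileMass n ψ) := mul_pos hε' hm
    have : 0 ≤ ε ^ 2 * (ε⁻¹ * profileMass n fun t => t * deriv ψ t) := by positivity
    linarith
  · rw [hen, ← sub_pos]
    have h1 := mul_pos hε' (sub_pos.2 hlt)
    have h2 : 0 ≤ (c - δ ^ 2) * (ε ^ 2 * (ε⁻¹ * profileMass n fun t => t * deriv ψ t)) :=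
      mul_nonneg (sub_pos.2 hc).le (by positivity)
    rw [hdir]
    linarith

end Sharpness

section Mollification

open Filter Topology ContinuousLinearMap
open scoped Convolution

variable {n : ℕ}

/-- Mollification of `f` by the normalized bump function `φ`. -/
noncomputable def mollify (φ : ContDiffBump (0 : EuclideanSpace ℝ (Fin n)))
    (f : EuclideanSpace ℝ (Fin n) → ℝ) : EuclideanSpace ℝ (Fin n) → ℝ :=
  φ.normed volume ⋆[lsmul ℝ ℝ, volume] f

variable (φ : ContDiffBump (0 : EuclideanSpace ℝ (Fin n))) {f : EuclideanSpace ℝ (Fin n) → ℝ}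

lemma contDiff_mollify (hf : Continuous f) : ContDiff ℝ (⊤ : ℕ∞) (mollify φ f) :=
  φ.hasCompactSupport_normed.contDiff_convolution_left _ φ.contDiff_normed
    hf.locallyIntegrable

lemma hasCompactSupport_mollify (hf : HasCompactSupport f) : HasCompactSupport (mollify φ f) :=
  φ.hasCompactSupport_normed.convolution _ hf

lemma partialDeriv_mollify (hf : ContDiff ℝ 1 f) (hc : HasCompactSupport f) (i : Fin n) :
    partialDeriv i (mollify φ f) = mollify φ (partialDeriv i f) := by
  have hφ : LocallyIntegrable (φ.normed volume) := φ.continuous_normed.locallyIntegrable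
  funext x
  rw [partialDeriv, mollify, (hc.hasFDerivAt_convolution_right (lsmul ℝ ℝ) hφ hf x).fderiv,
    convolution_precompR_apply _ hφ (hc.fderiv ℝ) (hf.continuous_fderiv one_ne_zero)]
  rfl

lemma tsupport_mollify_subset {r : ℝ} (hr : φ.rOut ≤ r) :
    tsupport (mollify φ f) ⊆ Metric.cthickening r (tsupport f) := by
  refine closure_minimal (fun x hx => ?_) Metric.isClosed_cthickening
  obtain ⟨y, hy, z, hz, rfl⟩ := support_convolution_subset _ hx
  rw [φ.support_normed_eq, mem_ball_zero_iff] at hy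
  refine Metric.mem_cthickening_of_dist_le _ z r _ (subset_tsupport _ hz) ?_
  rw [dist_eq_norm, add_sub_cancel_right]
  exact hy.le.trans hr

lemma abs_mollify_le (hf : Continuous f) {c : ℝ} (hc : ∀ x, |f x| ≤ c)
    (x : EuclideanSpace ℝ (Fin n)) : |mollify φ f x| ≤ 3 * c := by
  have h := φ.dist_normed_convolution_le (μ := volume) (x₀ := x) (ε := 2 * c)
    hf.aestronglyMeasurable fun y _ => by
      rw [Real.dist_eq]
      linarith [abs_sub (f y) (f x), hc x, hc y]
  rw [Real.dist_eq] at h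
  have h2 := abs_sub_abs_le_abs_sub (mollify φ f x) (f x)
  change |mollify φ f x - f x| ≤ _ at h
  linarith [hc x]

lemma exists_contDiffBump_seq {r : ℝ} (hr : 0 < r) :
    ∃ φ : ℕ → ContDiffBump (0 : EuclideanSpace ℝ (Fin n)), (∀ k, (φ k).rOut ≤ r) ∧
      Tendsto (fun k => (φ k).rOut) atTop (𝓝 0) := by
  have h0 : ∀ k : ℕ, 0 < r * (1 / ((k : ℝ) + 1)) := fun k => by positivity
  refine ⟨fun k => ⟨_, _, half_pos (h0 k), half_lt_self (h0 k)⟩, fun k => ?_, ?_⟩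
  · refine mul_le_of_le_one_right hr.le ?_
    rw [div_le_one (by positivity)]
    linarith [(Nat.cast_nonneg k : (0 : ℝ) ≤ k)]
  · simpa using tendsto_one_div_add_atTop_nhds_zero_nat.const_mul r

lemma tendsto_integral_norm_rpow_mul (β : ℝ) {K : Set (EuclideanSpace ℝ (Fin n))}
    (hK : IsCompact K) (h0 : 0 ∉ K) {G : ℕ → EuclideanSpace ℝ (Fin n) → ℝ}
    (hG : ∀ k, Continuous (G k)) (hGK : ∀ k x, x ∉ K → G k x = 0) {c : ℝ}
    (hc : ∀ k x, |G k x| ≤ c) (hlim : ∀ x, Tendsto (fun k => G k x) atTop (𝓝 (f x))) :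
    Tendsto (fun k => ∫ x, ‖x‖ ^ β * G k x) atTop (𝓝 (∫ x, ‖x‖ ^ β * f x)) := by
  have hcont : ContinuousOn (fun x : EuclideanSpace ℝ (Fin n) => ‖x‖ ^ β) K :=
    continuous_norm.continuousOn.rpow_const fun x hx =>
      Or.inl (norm_ne_zero_iff.2 fun h => h0 (h ▸ hx))
  obtain ⟨b, hb⟩ := hK.exists_bound_of_continuousOn hcont
  refine tendsto_integral_of_dominated_convergence (K.indicator fun _ => b * c)
    (fun k => ?_) ?_ (fun k => .of_forall fun x => ?_)
    (.of_forall fun x => (hlim x).const_mul _)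
  · exact ((measurable_norm.pow_const β).mul (hG k).measurable).aestronglyMeasurable
  · exact (integrable_indicator_iff hK.measurableSet).2 (integrableOn_const hK.measure_lt_top.ne)
  · by_cases hx : x ∈ K
    · rw [Set.indicator_of_mem hx, norm_mul]
      exact mul_le_mul (hb x hx) (hc k x) (norm_nonneg _) ((norm_nonneg _).trans (hb x hx))
    · rw [Set.indicator_of_notMem hx, hGK k x hx, mul_zero, norm_zero]

theorem hardy_rellich_of_contDiff_two (hn : 3 ≤ n) {α δ : ℝ} (hδ : δ = (n - α) / 2)
    (h : 0 ≤ (n : ℝ) - 1 + 2 * ((n - 4 + α) / 2) * δ - δ ^ 2)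
    {u : EuclideanSpace ℝ (Fin n) → ℝ} (hu : ContDiff ℝ 2 u) (hc : HasCompactSupport u)
    (h0 : (0 : EuclideanSpace ℝ (Fin n)) ∉ tsupport u) :
    δ ^ 2 * ∫ x, ‖x‖ ^ (α - 2) * ∑ i, partialDeriv i u x ^ 2 ≤
      ∫ x, ‖x‖ ^ α * (∑ i, partialDeriv i (partialDeriv i u) x) ^ 2 := by
  obtain ⟨r, hr, hrU⟩ := hc.isCompact.exists_cthickening_subset_open isOpen_compl_singleton
    (Set.subset_compl_singleton_iff.2 h0)
  obtain ⟨φ, hφr, hφ⟩ := exists_contDiffBump_seq (n := n) hr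
  have hK : IsCompact (Metric.cthickening r (tsupport u)) := hc.isCompact.cthickening
  have hK0 : (0 : EuclideanSpace ℝ (Fin n)) ∉ Metric.cthickening r (tsupport u) :=
    fun h => hrU h rfl
  have hu1 : ∀ i, ContDiff ℝ 1 (partialDeriv i u) := hu.partialDeriv (by norm_num)
  have hu2 : ∀ i, Continuous (partialDeriv i (partialDeriv i u)) := fun i =>
    ((hu1 i).partialDeriv (m := 0) (by norm_num) i).continuous
  have hd : ∀ k i, partialDeriv i (mollify (φ k) u) = mollify (φ k) (partialDeriv i u) :=
    fun k i => partialDeriv_mollify _ (hu.of_le (by norm_num)) hc i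
  have hdd : ∀ k i, partialDeriv i (partialDeriv i (mollify (φ k) u)) =
      mollify (φ k) (partialDeriv i (partialDeriv i u)) := fun k i => by
    rw [hd, partialDeriv_mollify _ (hu1 i) (hc.partialDeriv i)]
  have hz : ∀ k i x, x ∉ Metric.cthickening r (tsupport u) →
      partialDeriv i (mollify (φ k) u) x = 0 := fun k i x hx =>
    image_eq_zero_of_notMem_tsupport fun h =>
      hx (tsupport_mollify_subset _ (hφr k) (tsupport_partialDeriv_subset _ _ h))
  have hzz : ∀ k i x, x ∉ Metric.cthickening r (tsupport u) →
      partialDeriv i (partialDeriv i (mollify (φ k) u)) x = 0 := fun k i x hx =>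
    image_eq_zero_of_notMem_tsupport fun h => hx (tsupport_mollify_subset _ (hφr k)
      (tsupport_partialDeriv_subset _ _ (tsupport_partialDeriv_subset _ _ h)))
  choose c₁ hc₁ using fun i =>
    (hu1 i).continuous.bounded_above_of_compact_support (hc.partialDeriv i)
  choose c₂ hc₂ using fun i =>
    (hu2 i).bounded_above_of_compact_support ((hc.partialDeriv i).partialDeriv i)
  have hlim₁ := tendsto_integral_norm_rpow_mul (α - 2) hK hK0
    (G := fun k x => ∑ i, partialDeriv i (mollify (φ k) u) x ^ 2)
    (f := fun x => ∑ i, partialDeriv i u x ^ 2) (c := ∑ i, (3 * c₁ i) ^ 2)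
    (fun k => by
      simp only [hd]
      exact continuous_finsetSum _ fun i _ =>
        ((contDiff_mollify (φ k) (hu1 i).continuous).continuous).pow 2)
    (fun k x hx => Finset.sum_eq_zero fun i _ => by rw [hz k i x hx, sq, zero_mul])
    (fun k x => by
      rw [abs_of_nonneg (Finset.sum_nonneg fun i _ => sq_nonneg _)]
      refine Finset.sum_le_sum fun i _ => sq_le_sq' ?_ ?_ <;> rw [hd]
      · exact neg_le_of_abs_le (abs_mollify_le _ (hu1 i).continuous (hc₁ i) x)
      · exact le_of_abs_le (abs_mollify_le _ (hu1 i).continuous (hc₁ i) x))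
    (fun x => tendsto_finsetSum _ fun i _ => by
      simp only [hd]
      exact (ContDiffBump.convolution_tendsto_right_of_continuous hφ (hu1 i).continuous x).pow 2)
  have hlim₂ := tendsto_integral_norm_rpow_mul α hK hK0
    (G := fun k x => (∑ i, partialDeriv i (partialDeriv i (mollify (φ k) u)) x) ^ 2)
    (f := fun x => (∑ i, partialDeriv i (partialDeriv i u) x) ^ 2) (c := (∑ i, 3 * c₂ i) ^ 2)
    (fun k => by
      simp only [hdd]
      exact (continuous_finsetSum _ fun i _ =>
        (contDiff_mollify (φ k) (hu2 i)).continuous).pow 2)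
    (fun k x hx => by
      rw [Finset.sum_eq_zero fun i _ => hzz k i x hx, sq, zero_mul])
    (fun k x => by
      simp only [hdd]
      rw [abs_of_nonneg (sq_nonneg _), ← sq_abs]
      exact pow_le_pow_left₀ (abs_nonneg _) ((Finset.abs_sum_le_sum_abs _ _).trans
        (Finset.sum_le_sum fun i _ => abs_mollify_le _ (hu2 i) (hc₂ i) x)) 2)
    (fun x => Tendsto.pow (tendsto_finsetSum _ fun i _ => by
      simp only [hdd]
      exact ContDiffBump.convolution_tendsto_right_of_continuous hφ (hu2 i) x) 2)
  exact le_of_tendsto_of_tendsto' (hlim₁.const_mul _) hlim₂ fun k =>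
    hardy_rellich_of_smooth hn hδ h (contDiff_mollify _ hu.continuous)
      (hasCompactSupport_mollify _ hc) fun h => hK0 (tsupport_mollify_subset _ (hφr k) h)

end Mollification

lemma lap_eq_sum_partialDeriv {n : ℕ} {u : EuclideanSpace ℝ (Fin n) → ℝ} (hu : ContDiff ℝ 2 u)
    (x : EuclideanSpace ℝ (Fin n)) : lap u x = ∑ i, partialDeriv i (partialDeriv i u) x :=
  Finset.sum_congr rfl fun i _ => by
    rw [partialDeriv_partialDeriv hu.contDiffAt, iteratedFDeriv_two_apply]
    rfl

lemma norm_gradient_sq {n : ℕ} (u : EuclideanSpace ℝ (Fin n) → ℝ)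
    (x : EuclideanSpace ℝ (Fin n)) : ‖gradient u x‖ ^ 2 = ∑ i, partialDeriv i u x ^ 2 := by
  rw [EuclideanSpace.norm_sq_eq]
  refine Finset.sum_congr rfl fun i _ => ?_
  have h : inner ℝ (gradient u x) (EuclideanSpace.single i 1) = partialDeriv i u x :=
    InnerProductSpace.toDual_symm_apply
  rw [Real.norm_eq_abs, sq_abs, ← h, EuclideanSpace.inner_single_right, one_mul]
  rfl

theorem statement18 (n : ℕ) (hn : 3 ≤ n) (α : ℝ)
    (hα1 : ((n : ℝ) + 4 - 2 * Real.sqrt ((n : ℝ) ^ 2 - n + 1)) / 3 ≤ α)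
    (hα2 : α < n) (hα3 : α ≠ 4 - (n : ℝ)) :
    sInf {r : ℝ | ∃ u : EuclideanSpace ℝ (Fin n) → ℝ,
        ContDiff ℝ 2 u ∧ HasCompactSupport u ∧
        (0 : EuclideanSpace ℝ (Fin n)) ∉ tsupport u ∧
        (∫ x : EuclideanSpace ℝ (Fin n), ‖x‖ ^ (α - 2) * ‖gradient u x‖ ^ 2) ≠ 0 ∧
        r = (∫ x : EuclideanSpace ℝ (Fin n), ‖x‖ ^ α * (lap u x) ^ 2) /
            (∫ x : EuclideanSpace ℝ (Fin n), ‖x‖ ^ (α - 2) * ‖gradient u x‖ ^ 2)} =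
      (((n : ℝ) - α) / 2) ^ 2 := by
  have hcond : 0 ≤ (n : ℝ) - 1 + 2 * ((n - 4 + α) / 2) * ((n - α) / 2) - ((n - α) / 2) ^ 2 := by
    have hn' : (3 : ℝ) ≤ n := by exact_mod_cast hn
    have hs := Real.sq_sqrt (show 0 ≤ (n : ℝ) ^ 2 - n + 1 by nlinarith)
    have hs0 := Real.sqrt_nonneg ((n : ℝ) ^ 2 - n + 1)
    set s := Real.sqrt ((n : ℝ) ^ 2 - n + 1)
    have hs1 : (n : ℝ) - 2 ≤ s := by nlinarith
    nlinarith [mul_nonneg (show 0 ≤ 3 * α - (n + 4 - 2 * s) by linarith)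
      (show 0 ≤ n + 4 + 2 * s - 3 * α by linarith)]
  have key : ∀ c, ((n - α) / 2) ^ 2 < c → ∃ u : EuclideanSpace ℝ (Fin n) → ℝ,
      (ContDiff ℝ 2 u ∧ HasCompactSupport u ∧ (0 : EuclideanSpace ℝ (Fin n)) ∉ tsupport u ∧
        (∫ x : EuclideanSpace ℝ (Fin n), ‖x‖ ^ (α - 2) * ‖gradient u x‖ ^ 2) ≠ 0) ∧
      (∫ x : EuclideanSpace ℝ (Fin n), ‖x‖ ^ α * (lap u x) ^ 2) /
        (∫ x : EuclideanSpace ℝ (Fin n), ‖x‖ ^ (α - 2) * ‖gradient u x‖ ^ 2) < c := by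
    intro c hc
    obtain ⟨u, hu, hsupp, h0, hpos, hlt⟩ := exists_lt_mul_of_sq_lt (by omega) hα3 hc
    have hu2 : ContDiff ℝ 2 u := hu.of_le (WithTop.coe_le_coe.2 (le_top (a := (2 : ℕ∞))))
    refine ⟨u, ?_⟩
    simp only [lap_eq_sum_partialDeriv hu2, norm_gradient_sq]
    exact ⟨⟨hu2, hsupp, h0, hpos.ne'⟩, (div_lt_iff₀ hpos).2 hlt⟩
  refine csInf_eq_of_forall_ge_of_forall_gt_exists_lt ?_ ?_ fun c hc => ?_
  · obtain ⟨u, ⟨h1, h2, h3, h4⟩, -⟩ := key _ (lt_add_one _)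
    exact ⟨_, u, h1, h2, h3, h4, rfl⟩
  · rintro r ⟨u, hu, hsupp, h0, hne, rfl⟩
    have hpos := lt_of_le_of_ne (integral_nonneg fun x => by positivity) hne.symm
    rw [le_div_iff₀ hpos]
    simp only [lap_eq_sum_partialDeriv hu, norm_gradient_sq]
    exact hardy_rellich_of_contDiff_two hn rfl hcond hu hsupp h0
  · obtain ⟨u, ⟨h1, h2, h3, h4⟩, hlt⟩ := key c hc
    exact ⟨_, ⟨u, h1, h2, h3, h4, rfl⟩, hlt⟩
end

section
/- Let n ≥ 3 be an integer and let α ∈ ℝ with 4-n < α < 2. Suppose there exists a function u : ℝⁿ → ℝ of class C² with compact support contained in ℝⁿ \ {0} such that ∫_{ℝⁿ} |x|^{α-2} |∇u(x)|² dx ≠ 0 and ∫_{ℝⁿ} |x|^α |Δu(x)|² dx < ((n-α)/2)² ∫_{ℝⁿ} |x|^{α-2} |∇u(x)|² dx. Then ((n-α)/2)² - (n-4+α)(n-α)/2 > n-1; equivalently, 3α² - 2(n+4)α - n² + 4n + 4 > 0, and hence α < (n + 4 - 2√(n² - n + 1))/3. -/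
open MeasureTheory

open scoped Topology Convolution

set_option maxSynthPendingDepth 3 in
/-- Mixed first derivatives of two compactly supported `C¹` functions can be exchanged under the
integral sign. -/
theorem integral_fderiv_mul_fderiv_comm {E : Type*} [NormedAddCommGroup E]
    [NormedSpace ℝ E] [FiniteDimensional ℝ E] [MeasurableSpace E] [BorelSpace E]
    (μ : Measure E) [μ.IsAddHaarMeasure]
    {f g : E → ℝ} (hf : ContDiff ℝ 1 f) (hfc : HasCompactSupport f)
    (hg : ContDiff ℝ 1 g) (hgc : HasCompactSupport g) (v w : E) :
    ∫ x, fderiv ℝ f x v * fderiv ℝ g x w ∂μ = ∫ x, fderiv ℝ f x w * fderiv ℝ g x v ∂μ := by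
  obtain ⟨h, hh⟩ : ∃ h : E → ℝ, h = fun x => g (-x) := ⟨_, rfl⟩
  have hh1 : ContDiff ℝ 1 h := hh ▸ hg.comp contDiff_neg
  have hhc : HasCompactSupport h := hh ▸ hgc.comp_homeomorph (Homeomorph.neg E)
  have hdh : ∀ x, fderiv ℝ h (-x) = -fderiv ℝ g x := fun x => by
    have h1 : HasFDerivAt g (fderiv ℝ g x) (-(-x)) := by
      rw [neg_neg]
      exact (hg.differentiable one_ne_zero x).hasFDerivAt
    have h2 := h1.comp (-x) (hasFDerivAt_id (𝕜 := ℝ) (-x)).neg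
    rw [hh]
    refine h2.fderiv.trans ?_
    ext y
    simp
  obtain ⟨L, hL⟩ : ∃ L : ℝ →L[ℝ] ℝ →L[ℝ] ℝ, ∀ a b, L a b = a * b :=
    ⟨ContinuousLinearMap.mul ℝ ℝ, fun _ _ => rfl⟩
  obtain ⟨P, hP⟩ : ∃ P : ℝ →L[ℝ] (E →L[ℝ] ℝ) →L[ℝ] (E →L[ℝ] ℝ), P = L.precompR E := ⟨_, rfl⟩
  obtain ⟨Q, hQ⟩ : ∃ Q : (E →L[ℝ] ℝ) →L[ℝ] (E →L[ℝ] ℝ) →L[ℝ] (E →L[ℝ] E →L[ℝ] ℝ),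
    Q = P.precompL E := ⟨_, rfl⟩
  have hQ' : ∀ p q a b, Q p q a b = p a * q b := fun p q a b => by
    rw [hQ, hP, ContinuousLinearMap.precompL_apply, ContinuousLinearMap.precompR,
      ContinuousLinearMap.comp_apply, ContinuousLinearMap.compL_apply,
      ContinuousLinearMap.comp_apply, hL]
  have hfd := hf.continuous_fderiv one_ne_zero
  have hhd := hh1.continuous_fderiv one_ne_zero
  have h1 : ∀ y, HasFDerivAt (f ⋆[L, μ] h) ((f ⋆[P, μ] fderiv ℝ h) y) y :=
    fun y => hP ▸ hhc.hasFDerivAt_convolution_right L hf.continuous.locallyIntegrable hh1 y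
  have h2 : HasFDerivAt (f ⋆[P, μ] fderiv ℝ h)
      ((fderiv ℝ f ⋆[Q, μ] fderiv ℝ h) 0) 0 :=
    hQ ▸ hfc.hasFDerivAt_convolution_left P hf hhd.locallyIntegrable 0
  have hsymm := second_derivative_symmetric h1 h2 v w
  have hint : Integrable (fun t => Q (fderiv ℝ f t) (fderiv ℝ h (0 - t))) μ :=
    (hfc.fderiv ℝ).convolutionExists_left Q hfd hhd.locallyIntegrable 0
  have key : ∀ a b : E, (fderiv ℝ f ⋆[Q, μ] fderiv ℝ h) 0 a b
      = -∫ x, fderiv ℝ f x a * fderiv ℝ g x b ∂μ := by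
    intro a b
    rw [convolution_def, ContinuousLinearMap.integral_apply hint,
      ContinuousLinearMap.integral_apply (hint.apply_continuousLinearMap a), ← integral_neg]
    refine integral_congr_ae (Filter.Eventually.of_forall fun t => ?_)
    simp only [hQ', zero_sub, hdh, neg_apply, mul_neg]
  rw [key, key] at hsymm
  exact neg_injective hsymm

/-- Functions of class `C^k` with compact support which vanish near the origin. -/
structure PuncturedTest {n : ℕ} (k : WithTop ℕ∞) (f : EuclideanSpace ℝ (Fin n) → ℝ) : Prop where
  contDiff : ContDiff ℝ k f
  hasCompactSupport : HasCompactSupport f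
  eventuallyEq_zero : f =ᶠ[𝓝 0] 0

/-- The `i`-th partial derivative. -/
noncomputable def partialD {n : ℕ} (i : Fin n) (f : EuclideanSpace ℝ (Fin n) → ℝ)
    (x : EuclideanSpace ℝ (Fin n)) : ℝ :=
  fderiv ℝ f x (EuclideanSpace.single i 1)

section PartialD

variable {n : ℕ} {f g : EuclideanSpace ℝ (Fin n) → ℝ} {x : EuclideanSpace ℝ (Fin n)}

theorem partialD_mul (i : Fin n) (hf : DifferentiableAt ℝ f x) (hg : DifferentiableAt ℝ g x) :
    partialD i (fun y => f y * g y) x = partialD i f x * g x + f x * partialD i g x := by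
  simp only [partialD, fderiv_fun_mul hf hg, add_apply, smul_apply, smul_eq_mul]
  ring

theorem partialD_sum {ι : Type*} (s : Finset ι) (i : Fin n)
    {F : ι → EuclideanSpace ℝ (Fin n) → ℝ} (hF : ∀ j ∈ s, DifferentiableAt ℝ (F j) x) :
    partialD i (fun y => ∑ j ∈ s, F j y) x = ∑ j ∈ s, partialD i (F j) x := by
  simp [partialD, fderiv_fun_sum hF]

theorem partialD_coord (i k : Fin n) :
    partialD i (fun y : EuclideanSpace ℝ (Fin n) => y k) x = if i = k then 1 else 0 := by
  have : (fun y : EuclideanSpace ℝ (Fin n) => y k) = EuclideanSpace.proj (𝕜 := ℝ) k := rfl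
  rw [partialD, this, ContinuousLinearMap.fderiv]
  simp [eq_comm]

theorem hasFDerivAt_norm_rpow_of_ne {E : Type*} [NormedAddCommGroup E] [InnerProductSpace ℝ E]
    {x : E} (hx : x ≠ 0) (β : ℝ) :
    HasFDerivAt (fun y : E => ‖y‖ ^ β) ((β * ‖x‖ ^ (β - 2)) • innerSL ℝ x) x := by
  have hx0 : 0 < ‖x‖ := norm_pos_iff.2 hx
  have h1 := (hasStrictFDerivAt_norm_sq x).hasFDerivAt.rpow_const (p := β / 2)
    (Or.inl (by positivity))
  have h2 : (fun y : E => (‖y‖ ^ 2) ^ (β / 2)) = fun y => ‖y‖ ^ β := by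
    ext y
    rw [← Real.rpow_natCast, ← Real.rpow_mul (norm_nonneg y)]
    congr 1; push_cast; ring
  rw [h2] at h1
  convert h1 using 1
  have h3 : (‖x‖ ^ 2) ^ (β / 2 - 1) = ‖x‖ ^ (β - 2) := by
    rw [← Real.rpow_natCast ‖x‖ 2, ← Real.rpow_mul hx0.le]
    congr 1; push_cast; ring
  ext y
  simp [h3]
  ring

theorem partialD_norm_rpow (hx : x ≠ 0) (β : ℝ) (i : Fin n) :
    partialD i (fun y : EuclideanSpace ℝ (Fin n) => ‖y‖ ^ β) x = β * ‖x‖ ^ (β - 2) * x i := by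
  rw [partialD, (hasFDerivAt_norm_rpow_of_ne hx β).fderiv]
  simp [EuclideanSpace.inner_single_right]

theorem contDiffAt_norm_rpow (hx : x ≠ 0) (β : ℝ) (k : WithTop ℕ∞) :
    ContDiffAt ℝ k (fun y : EuclideanSpace ℝ (Fin n) => ‖y‖ ^ β) x :=
  (contDiffAt_norm ℝ hx).rpow_const_of_ne (norm_ne_zero_iff.2 hx)

theorem contDiff_coord (i : Fin n) (k : WithTop ℕ∞) :
    ContDiff ℝ k (fun y : EuclideanSpace ℝ (Fin n) => y i) :=
  (EuclideanSpace.proj (𝕜 := ℝ) i).contDiff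

end PartialD

namespace PuncturedTest

variable {n : ℕ} {k : WithTop ℕ∞} {f g : EuclideanSpace ℝ (Fin n) → ℝ}

theorem mul_left (hf : PuncturedTest k f) (hg : ∀ x ≠ 0, ContDiffAt ℝ k g x) :
    PuncturedTest k (fun x => g x * f x) := by
  have h0 : (fun x => g x * f x) =ᶠ[𝓝 0] 0 := by
    filter_upwards [hf.eventuallyEq_zero] with x hx
    simp [hx]
  refine ⟨contDiff_iff_contDiffAt.2 fun x => ?_, hf.hasCompactSupport.mul_left, h0⟩
  rcases eq_or_ne x 0 with rfl | hx
  · exact contDiffAt_const.congr_of_eventuallyEq h0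
  · exact (hg x hx).mul hf.contDiff.contDiffAt

theorem mul (hf : PuncturedTest k f) (hg : PuncturedTest k g) :
    PuncturedTest k (fun x => f x * g x) :=
  hg.mul_left fun _ _ => hf.contDiff.contDiffAt

theorem norm_rpow_mul (hf : PuncturedTest k f) (β : ℝ) :
    PuncturedTest k (fun x => ‖x‖ ^ β * f x) :=
  hf.mul_left fun _ hx => contDiffAt_norm_rpow hx β k

theorem coord_mul (hf : PuncturedTest k f) (i : Fin n) :
    PuncturedTest k (fun x => x i * f x) :=
  hf.mul_left fun _ _ => (contDiff_coord i k).contDiffAt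

theorem zero : PuncturedTest k (fun _ : EuclideanSpace ℝ (Fin n) => (0 : ℝ)) :=
  ⟨contDiff_const, HasCompactSupport.zero, Filter.EventuallyEq.rfl⟩

theorem add (hf : PuncturedTest k f) (hg : PuncturedTest k g) :
    PuncturedTest k (fun x => f x + g x) := by
  refine ⟨hf.contDiff.add hg.contDiff, hf.hasCompactSupport.add hg.hasCompactSupport, ?_⟩
  filter_upwards [hf.eventuallyEq_zero, hg.eventuallyEq_zero] with x hx hy
  simp [hx, hy]

theorem sub (hf : PuncturedTest k f) (hg : PuncturedTest k g) :
    PuncturedTest k (fun x => f x - g x) := by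
  refine ⟨hf.contDiff.sub hg.contDiff, hf.hasCompactSupport.sub hg.hasCompactSupport, ?_⟩
  filter_upwards [hf.eventuallyEq_zero, hg.eventuallyEq_zero] with x hx hy
  simp [hx, hy]

theorem sum {ι : Type*} (s : Finset ι) {F : ι → EuclideanSpace ℝ (Fin n) → ℝ}
    (hF : ∀ i ∈ s, PuncturedTest k (F i)) : PuncturedTest k (fun x => ∑ i ∈ s, F i x) := by
  classical
  induction s using Finset.induction_on with
  | empty => simpa using zero
  | insert a s ha ih =>
    simp only [Finset.sum_insert ha]
    exact (hF a (by simp)).add (ih fun i hi => hF i (by simp [hi]))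

theorem partialD {m : WithTop ℕ∞} (hf : PuncturedTest k f) (h : m + 1 ≤ k) (i : Fin n) :
    PuncturedTest m (_root_.partialD i f) := by
  refine ⟨(hf.contDiff.fderiv_right h).clm_apply contDiff_const,
    hf.hasCompactSupport.fderiv_apply ℝ _, ?_⟩
  filter_upwards [hf.eventuallyEq_zero.fderiv (𝕜 := ℝ)] with x hx
  simp [_root_.partialD, hx]

theorem differentiableAt (hf : PuncturedTest 1 f) (x : EuclideanSpace ℝ (Fin n)) :
    DifferentiableAt ℝ f x :=
  (hf.contDiff.differentiable one_ne_zero) x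

theorem integrable (hf : PuncturedTest k f) : Integrable f :=
  hf.contDiff.continuous.integrable_of_hasCompactSupport hf.hasCompactSupport

theorem integral_partialD_eq_zero (hf : PuncturedTest 1 f) (i : Fin n) :
    ∫ x, _root_.partialD i f x = 0 := by
  have h1 : Integrable fun x => fderiv ℝ f x (EuclideanSpace.single i 1) :=
    (hf.partialD (m := 0) (by simp) i).integrable
  have := integral_mul_fderiv_eq_neg_fderiv_mul_of_integrable (μ := volume)
    (f := fun _ : EuclideanSpace ℝ (Fin n) => (1 : ℝ)) (g := f)
    (v := EuclideanSpace.single i 1) (by simp) (by simpa using h1) (by simpa using hf.integrable)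
    (fun x _ => differentiableAt_const _) (fun x _ => hf.differentiableAt x)
  simpa [_root_.partialD] using this

theorem divergence {Φ : Fin n → EuclideanSpace ℝ (Fin n) → ℝ}
    (hΦ : ∀ i, PuncturedTest 1 (Φ i)) :
    PuncturedTest 0 fun x => ∑ i, _root_.partialD i (Φ i) x :=
  sum _ fun i _ => (hΦ i).partialD (by simp) i

theorem integral_divergence_eq_zero {Φ : Fin n → EuclideanSpace ℝ (Fin n) → ℝ}
    (hΦ : ∀ i, PuncturedTest 1 (Φ i)) : ∫ x, ∑ i, _root_.partialD i (Φ i) x = 0 := by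
  rw [integral_finsetSum _ fun i _ => ((hΦ i).partialD (m := 0) (by simp) i).integrable]
  exact Finset.sum_eq_zero fun i _ => (hΦ i).integral_partialD_eq_zero i

theorem null_lagrangian {Φ Ψ : Fin n → EuclideanSpace ℝ (Fin n) → ℝ}
    (hΦ : ∀ i, PuncturedTest 1 (Φ i)) (hΨ : ∀ i, PuncturedTest 1 (Ψ i)) :
    PuncturedTest 0 fun x =>
      ∑ i, ∑ j, (_root_.partialD i (Φ i) x * _root_.partialD j (Ψ j) x -
        _root_.partialD j (Φ i) x * _root_.partialD i (Ψ j) x) := by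
  have hI : ∀ i j a b, PuncturedTest 0 fun x =>
      _root_.partialD a (Φ i) x * _root_.partialD b (Ψ j) x := fun i j a b =>
    ((hΦ i).partialD (by simp) a).mul ((hΨ j).partialD (by simp) b)
  exact sum _ fun i _ => sum _ fun j _ => (hI i j i j).sub (hI i j j i)

theorem integral_null_lagrangian_eq_zero {Φ Ψ : Fin n → EuclideanSpace ℝ (Fin n) → ℝ}
    (hΦ : ∀ i, PuncturedTest 1 (Φ i)) (hΨ : ∀ i, PuncturedTest 1 (Ψ i)) :
    ∫ x, ∑ i, ∑ j, (_root_.partialD i (Φ i) x * _root_.partialD j (Ψ j) x -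
      _root_.partialD j (Φ i) x * _root_.partialD i (Ψ j) x) = 0 := by
  have hI : ∀ i j a b, Integrable fun x =>
      _root_.partialD a (Φ i) x * _root_.partialD b (Ψ j) x := fun i j a b =>
    (((hΦ i).partialD (m := 0) (by simp) a).mul ((hΨ j).partialD (m := 0) (by simp) b)).integrable
  have hJ : ∀ i j, Integrable fun x =>
      _root_.partialD i (Φ i) x * _root_.partialD j (Ψ j) x -
        _root_.partialD j (Φ i) x * _root_.partialD i (Ψ j) x := fun i j =>
    (hI i j i j).sub (hI i j j i)
  rw [integral_finsetSum _ fun i _ => integrable_finsetSum _ fun j _ => hJ i j]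
  refine Finset.sum_eq_zero fun i _ => ?_
  rw [integral_finsetSum _ fun j _ => hJ i j]
  refine Finset.sum_eq_zero fun j _ => ?_
  rw [integral_sub (hI i j i j) (hI i j j i), sub_eq_zero]
  exact integral_fderiv_mul_fderiv_comm volume (hΦ i).contDiff (hΦ i).hasCompactSupport
    (hΨ j).contDiff (hΨ j).hasCompactSupport _ _

end PuncturedTest

section Algebra

variable {n : ℕ} (x p : Fin n → ℝ) (Q : Fin n → Fin n → ℝ)

theorem sum_null_lagrangian_weighted (hQ : ∀ i j, Q i j = Q j i) (c d : ℝ) :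
    ∑ i, ∑ j, ((c * x i * p i + d * Q i i) * Q j j - (c * x j * p i + d * Q i j) * Q j i) =
      d * ((∑ i, Q i i) ^ 2 - ∑ i, ∑ j, Q i j ^ 2) +
        c * ((∑ i, x i * p i) * (∑ i, Q i i) - ∑ i, p i * ∑ j, Q i j * x j) := by
  simp only [sq (∑ i, Q i i), Finset.sum_mul_sum]
  simp only [Finset.mul_sum, mul_sub,
    ← Finset.sum_add_distrib, ← Finset.sum_sub_distrib]
  refine Finset.sum_congr rfl fun i _ => Finset.sum_congr rfl fun j _ => ?_
  rw [hQ j i]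
  ring

theorem sum_null_lagrangian_radial (b : Fin n → ℝ)
    (hb : ∀ i, b i = ∑ j, Q i j * x j) (c d s : ℝ) (hs : s = ∑ i, x i * p i) :
    ∑ i, ∑ j, ((c * x i * (x i * s) + d * ((if i = i then 1 else 0) * s + x i * (p i + b i)))
          * Q j j -
        (c * x j * (x i * s) + d * ((if j = i then 1 else 0) * s + x i * (p j + b j))) * Q j i) =
      c * s * ((∑ i, x i ^ 2) * (∑ i, Q i i) - ∑ i, x i * b i) +
        d * ((∑ i, x i * b i) * (∑ i, Q i i) - ∑ i, b i ^ 2 + n * s * (∑ i, Q i i) -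
          ∑ i, p i * b i) := by
  have hT : ∀ i, ∑ j, (if j = i then 1 else 0) * s * Q j i = s * Q i i := by
    intro i
    simp [ite_mul]
  have hb' : ∀ j, ∑ i, x i * Q j i = b j := fun j => by
    rw [hb]; exact Finset.sum_congr rfl fun i _ => mul_comm _ _
  have h1 : ∑ i, ∑ j, x i * x j * Q j i = ∑ i, x i * b i := by
    rw [Finset.sum_comm]
    refine Finset.sum_congr rfl fun j _ => ?_
    rw [← hb', Finset.mul_sum]
    exact Finset.sum_congr rfl fun i _ => by ring
  have h2 : ∑ i, ∑ j, x i * (p j + b j) * Q j i = ∑ i, (p i + b i) * b i := by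
    rw [Finset.sum_comm]
    refine Finset.sum_congr rfl fun j _ => ?_
    rw [← hb' j, Finset.mul_sum]
    exact Finset.sum_congr rfl fun i _ => by ring
  calc _ = ∑ i, ((c * s * (x i ^ 2) + d * (s + x i * p i + x i * b i)) * (∑ j, Q j j) -
        (c * s * ∑ j, x i * x j * Q j i + d * (∑ j, (if j = i then 1 else 0) * s * Q j i +
          ∑ j, x i * (p j + b j) * Q j i))) := by
        refine Finset.sum_congr rfl fun i _ => ?_
        simp only [Finset.mul_sum, ← Finset.sum_add_distrib, ← Finset.sum_sub_distrib]
        refine Finset.sum_congr rfl fun j _ => ?_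
        simp only [if_true]
        ring
    _ = _ := by
        simp only [hT, Finset.sum_sub_distrib, ← Finset.sum_mul, Finset.sum_add_distrib,
          ← Finset.mul_sum, h1, h2, add_mul, ← hs, ← sq, Finset.sum_const, Finset.card_univ,
          Fintype.card_fin, nsmul_eq_mul]
        ring

/-- The trace inequality for the part of a quadratic form tangential to the sphere through `x`. -/
theorem sq_tangential_trace_le (hQ : ∀ i j, Q i j = Q j i) (hn : 1 < n) (b : Fin n → ℝ)
    (hb : ∀ i, b i = ∑ j, Q i j * x j) (hx : 0 < ∑ i, x i ^ 2) :
    ((∑ i, x i ^ 2) * (∑ i, Q i i) - ∑ i, x i * b i) ^ 2 ≤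
      (n - 1) * ((∑ i, x i ^ 2) ^ 2 * (∑ i, ∑ j, Q i j ^ 2) -
        2 * (∑ i, x i ^ 2) * (∑ i, b i ^ 2) + (∑ i, x i * b i) ^ 2) := by
  have hn' : (1 : ℝ) < n := by exact_mod_cast hn
  set ρ := ∑ i, x i ^ 2 with hρ
  set T := ∑ i, Q i i with hT
  set a := ∑ i, x i * b i with ha
  set c := (ρ * T - a) / (n - 1) with hc
  have hcn : c * (n - 1) = ρ * T - a := by rw [hc]; field_simp [sub_ne_zero.2 hn'.ne']
  have h0 : 0 ≤ ∑ i, ∑ j, (ρ * (ρ * Q i j - b i * x j - x i * b j - c * (if i = j then 1 else 0))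
      + (a + c) * (x i * x j)) ^ 2 :=
    Finset.sum_nonneg fun i _ => Finset.sum_nonneg fun j _ => sq_nonneg _
  have e1 : ∀ i, ∑ j, Q i j * x j = b i := fun i => (hb i).symm
  have e2 : ∑ i, ∑ j, (ρ * (ρ * Q i j - b i * x j - x i * b j - c * (if i = j then 1 else 0))
      + (a + c) * (x i * x j)) ^ 2 = ρ ^ 2 * (ρ ^ 2 * (∑ i, ∑ j, Q i j ^ 2) -
        2 * ρ * (∑ i, b i ^ 2) + a ^ 2 - 2 * c * (ρ * T - a) + c ^ 2 * (n - 1)) := by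
    have e3 : ∀ i, ∑ j, (ρ * (ρ * Q i j - b i * x j - x i * b j - c * (if i = j then 1 else 0))
      + (a + c) * (x i * x j)) ^ 2 = ρ ^ 4 * (∑ j, Q i j ^ 2) + ρ ^ 2 * b i ^ 2 * ρ
        + ρ ^ 2 * x i ^ 2 * (∑ j, b j ^ 2) + ρ ^ 2 * c ^ 2 + (a + c) ^ 2 * x i ^ 2 * ρ
        - 2 * ρ ^ 3 * b i * b i - 2 * ρ ^ 3 * x i * (∑ j, Q i j * b j) - 2 * ρ ^ 3 * c * Q i i
        + 2 * ρ ^ 2 * (a + c) * x i * b i + 2 * ρ ^ 2 * x i * b i * a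
        + 2 * ρ ^ 2 * c * (x i * b i) - 2 * ρ * (a + c) * (x i * b i) * ρ
        + 2 * ρ ^ 2 * c * (x i * b i)
        - 2 * ρ * (a + c) * x i ^ 2 * a - 2 * ρ * c * (a + c) * x i ^ 2 := by
      intro i
      have d1 : ∀ f : Fin n → ℝ, ∑ j, (if i = j then 1 else 0) * f j = f i := fun f => by
        simp [ite_mul]
      have d2 : ∀ j, ((if i = j then 1 else 0 : ℝ)) ^ 2 = (if i = j then 1 else 0) * 1 := by
        intro j; split_ifs <;> norm_num
      calc _ = ∑ j, (ρ ^ 4 * Q i j ^ 2 + ρ ^ 2 * b i ^ 2 * x j ^ 2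
        + ρ ^ 2 * x i ^ 2 * b j ^ 2 + ρ ^ 2 * c ^ 2 * ((if i = j then 1 else 0) * 1)
        + (a + c) ^ 2 * x i ^ 2 * x j ^ 2
        - 2 * ρ ^ 3 * b i * (Q i j * x j) - 2 * ρ ^ 3 * x i * (Q i j * b j)
        - 2 * ρ ^ 3 * c * ((if i = j then 1 else 0) * Q i j)
        + 2 * ρ ^ 2 * (a + c) * x i * (Q i j * x j) + 2 * ρ ^ 2 * x i * b i * (x j * b j)
        + 2 * ρ ^ 2 * c * b i * ((if i = j then 1 else 0) * x j)
        - 2 * ρ * (a + c) * (x i * b i) * x j ^ 2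
        + 2 * ρ ^ 2 * c * x i * ((if i = j then 1 else 0) * b j)
        - 2 * ρ * (a + c) * x i ^ 2 * (x j * b j)
        - 2 * ρ * c * (a + c) * x i * ((if i = j then 1 else 0) * x j)) := by
            refine Finset.sum_congr rfl fun j _ => ?_
            rw [← d2]
            ring
        _ = _ := by
            simp only [Finset.sum_add_distrib, Finset.sum_sub_distrib, ← Finset.mul_sum, d1, e1,
              ← hρ, ← ha]
            ring
    have e4 : ∑ i, x i * ∑ j, Q i j * b j = ∑ i, b i ^ 2 := by
      simp only [Finset.mul_sum]
      rw [Finset.sum_comm]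
      refine Finset.sum_congr rfl fun j _ => ?_
      rw [sq]
      nth_rewrite 2 [hb j]
      rw [Finset.sum_mul]
      exact Finset.sum_congr rfl fun i _ => by rw [hQ i j]; ring
    simp only [e3]
    calc _ = ∑ i, (ρ ^ 4 * (∑ j, Q i j ^ 2) - ρ ^ 3 * b i ^ 2
        + ρ ^ 2 * (∑ j, b j ^ 2) * x i ^ 2 + (a + c) ^ 2 * ρ * x i ^ 2 + ρ ^ 2 * c ^ 2
        - 2 * ρ ^ 3 * (x i * (∑ j, Q i j * b j)) - 2 * ρ ^ 3 * c * Q i i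
        + (2 * ρ ^ 2 * a + 4 * ρ ^ 2 * c) * (x i * b i)
        - 2 * ρ * (a + c) * a * x i ^ 2 - 2 * ρ * c * (a + c) * x i ^ 2) := by
          refine Finset.sum_congr rfl fun i _ => ?_
          ring
      _ = _ := by
          simp only [Finset.sum_add_distrib, Finset.sum_sub_distrib, ← Finset.mul_sum, e4,
            ← hρ, ← ha, ← hT, Finset.sum_const, Finset.card_univ, Fintype.card_fin, nsmul_eq_mul]
          ring
  rw [e2] at h0
  have h1 := nonneg_of_mul_nonneg_right h0 (by positivity : 0 < ρ ^ 2)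
  have h2 := mul_nonneg (sub_pos.2 hn').le h1
  nlinarith [h2, hcn]

/-- The algebraic form of the Rellich–Hardy inequality: the difference of the two densities is a
sum of nonnegative terms, up to the null Lagrangians. -/
theorem rellich_density_nonneg {ν α ρ T s a m bb qq pp : ℝ} (hν : 2 < ν)
    (hα : ((ν - α) / 2) ^ 2 - (ν - 4 + α) * (ν - α) / 2 ≤ ν - 1)
    (h2 : 0 ≤ ρ * (bb + (ν - 2 + α) * m + ((ν - 2 + α) / 2) ^ 2 * pp) -
      (a + (ν - 2 + α) / 2 * s) ^ 2)
    (h3 : (ρ * T - a) ^ 2 ≤ (ν - 1) * (ρ ^ 2 * qq - 2 * ρ * bb + a ^ 2))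
    (h4 : s ^ 2 ≤ ρ * pp) :
    0 ≤ ρ ^ 2 * T ^ 2 - ((ν - α) / 2) ^ 2 * (ρ * pp)
      - (ν - 1) / (ν - 2) * (ρ ^ 2 * (T ^ 2 - qq) + α * ρ * (s * T - m))
      + 2 / (ν - 2) * ((α - 2) * s * (ρ * T - a) + ρ * (a * T - bb + ν * s * T - m))
      + (ν - 1 + 1 / (ν - 2)) *
        (ρ * ((ν + α - 2) * pp + 2 * m))
      - (2 - (ν - 3) * α / (ν - 2)) * ((α - 2) * s ^ 2 + ρ * (m + pp + s * T))
      - ((ν - 2 + α) / 2 - (α - 2) / (ν - 2)) * ((ν + α - 2) * s ^ 2 + 2 * s * a) := by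
  have h5 : 0 < ν - 2 := sub_pos.2 hν
  have h6 := mul_nonneg (inv_nonneg.2 h5.le) (sub_nonneg.2 h3)
  have h7 := mul_nonneg (sub_nonneg.2 hα) (sub_nonneg.2 h4)
  have h8 := sq_nonneg (a + (ν - 2 + α) / 2 * s)
  refine (add_nonneg (add_nonneg h8 (mul_nonneg zero_le_two h2)) (add_nonneg h6 h7)).trans_eq ?_
  field_simp
  ring

end Algebra

section Fields

variable {n : ℕ} {f : EuclideanSpace ℝ (Fin n) → ℝ} {x : EuclideanSpace ℝ (Fin n)}

theorem partialD_norm_rpow_mul (hx : x ≠ 0) (hf : DifferentiableAt ℝ f x) (β : ℝ) (i : Fin n) :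
    partialD i (fun y => ‖y‖ ^ β * f y) x =
      β * ‖x‖ ^ (β - 2) * x i * f x + ‖x‖ ^ β * partialD i f x := by
  rw [partialD_mul i (hasFDerivAt_norm_rpow_of_ne hx β).differentiableAt hf,
    partialD_norm_rpow hx]

theorem partialD_coord_mul (hf : DifferentiableAt ℝ f x) (i k : Fin n) :
    partialD i (fun y => y k * f y) x = (if i = k then 1 else 0) * f x + x k * partialD i f x := by
  rw [partialD_mul i ((contDiff_coord k 1).differentiable one_ne_zero x) hf, partialD_coord]

/-- The divergence of a weighted radial field. -/
theorem sum_partialD_norm_rpow_mul_coord_mul (hx : x ≠ 0) (hf : DifferentiableAt ℝ f x) (β : ℝ) :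
    ∑ i, partialD i (fun y => ‖y‖ ^ β * (y i * f y)) x =
      ‖x‖ ^ β * ((β + n) * f x + ∑ i, x i * partialD i f x) := by
  have h1 : ∀ i, partialD i (fun y => ‖y‖ ^ β * (y i * f y)) x =
      β * ‖x‖ ^ (β - 2) * f x * x i ^ 2 + ‖x‖ ^ β * (f x + x i * partialD i f x) := fun i => by
    have hd : DifferentiableAt ℝ (fun y : EuclideanSpace ℝ (Fin n) => y i * f y) x :=
      ((contDiff_coord i 1).differentiable one_ne_zero x).fun_mul hf
    rw [partialD_norm_rpow_mul hx hd, partialD_coord_mul hf, if_pos rfl]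
    ring
  have h2 : ‖x‖ ^ (β - 2) * ∑ i, x i ^ 2 = ‖x‖ ^ β := by
    rw [← EuclideanSpace.real_norm_sq_eq, ← Real.rpow_add_natCast (norm_ne_zero_iff.2 hx)]
    congr 1; push_cast; ring
  simp only [h1, Finset.sum_add_distrib, ← Finset.mul_sum, Finset.sum_const, Finset.card_univ,
    Fintype.card_fin, nsmul_eq_mul]
  rw [← h2]
  ring

theorem sum_partialD_norm_rpow_mul (hx : x ≠ 0) {F : Fin n → EuclideanSpace ℝ (Fin n) → ℝ}
    (hF : ∀ i, DifferentiableAt ℝ (F i) x) (β : ℝ) :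
    ∑ i, partialD i (fun y => ‖y‖ ^ β * F i y) x =
      β * ‖x‖ ^ (β - 2) * (∑ i, x i * F i x) + ‖x‖ ^ β * ∑ i, partialD i (F i) x := by
  simp only [partialD_norm_rpow_mul hx (hF _), Finset.sum_add_distrib, Finset.mul_sum, mul_assoc]

end Fields

theorem partialD_partialD_eq {n : ℕ} {u : EuclideanSpace ℝ (Fin n) → ℝ} (hu : ContDiff ℝ 2 u)
    (x : EuclideanSpace ℝ (Fin n)) (i j : Fin n) :
    partialD i (partialD j u) x = fderiv ℝ (fderiv ℝ u) x (EuclideanSpace.single i 1)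
      (EuclideanSpace.single j 1) := by
  have h : DifferentiableAt ℝ (fderiv ℝ u) x :=
    (hu.fderiv_right (m := 1) (by norm_num)).differentiable one_ne_zero x
  change fderiv ℝ (fun y => fderiv ℝ u y (EuclideanSpace.single j 1)) x _ = _
  rw [fderiv_clm_apply h (differentiableAt_const _)]
  simp

theorem partialD_partialD_comm {n : ℕ} {u : EuclideanSpace ℝ (Fin n) → ℝ} (hu : ContDiff ℝ 2 u)
    (x : EuclideanSpace ℝ (Fin n)) (i j : Fin n) :
    partialD i (partialD j u) x = partialD j (partialD i u) x := by
  rw [partialD_partialD_eq hu, partialD_partialD_eq hu]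
  exact second_derivative_symmetric
    (fun y => (hu.differentiable two_ne_zero y).hasFDerivAt)
    ((hu.fderiv_right (m := 1) (by norm_num)).differentiable one_ne_zero x).hasFDerivAt _ _

theorem lap_eq_sum_partialD {n : ℕ} {u : EuclideanSpace ℝ (Fin n) → ℝ} (hu : ContDiff ℝ 2 u)
    (x : EuclideanSpace ℝ (Fin n)) : lap u x = ∑ i, partialD i (partialD i u) x := by
  refine Finset.sum_congr rfl fun i _ => ?_
  rw [partialD_partialD_eq hu, iteratedFDeriv_two_apply]
  simp

theorem norm_gradient_sq_eq_sum {n : ℕ} (u : EuclideanSpace ℝ (Fin n) → ℝ)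
    (x : EuclideanSpace ℝ (Fin n)) : ‖gradient u x‖ ^ 2 = ∑ i, partialD i u x ^ 2 := by
  rw [EuclideanSpace.real_norm_sq_eq]
  refine Finset.sum_congr rfl fun i _ => ?_
  have : inner ℝ (gradient u x) (EuclideanSpace.single i (1 : ℝ)) = partialD i u x := by
    rw [gradient, InnerProductSpace.toDual_symm_apply, partialD]
  rw [← this, EuclideanSpace.inner_single_right]
  simp

/-- The pointwise inequality behind the weighted Rellich–Hardy inequality: up to null Lagrangians
and divergences, the difference of the two densities is nonnegative. -/
theorem rellich_hardy_pointwise {n : ℕ} (hn : 3 ≤ n) (α : ℝ)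
    (hα : ((n - α) / 2) ^ 2 - (n - 4 + α) * (n - α) / 2 ≤ (n : ℝ) - 1)
    {u : EuclideanSpace ℝ (Fin n) → ℝ} (hu : PuncturedTest 2 u)
    {x : EuclideanSpace ℝ (Fin n)} (hx : x ≠ 0) :
    0 ≤ ‖x‖ ^ α * ((∑ i, partialD i (partialD i u) x) * ∑ i, partialD i (partialD i u) x)
      - ((n - α) / 2) ^ 2 * (‖x‖ ^ (α - 2) * ∑ i, partialD i u x * partialD i u x)
      - (n - 1) / (n - 2) * ∑ i, ∑ j,
        (partialD i (fun y => ‖y‖ ^ α * partialD i u y) x * partialD j (partialD j u) x -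
          partialD j (fun y => ‖y‖ ^ α * partialD i u y) x * partialD i (partialD j u) x)
      + 2 / (n - 2) * ∑ i, ∑ j,
        (partialD i (fun y => ‖y‖ ^ (α - 2) * (y i * ∑ k, y k * partialD k u y)) x *
            partialD j (partialD j u) x -
          partialD j (fun y => ‖y‖ ^ (α - 2) * (y i * ∑ k, y k * partialD k u y)) x *
            partialD i (partialD j u) x)
      + (n - 1 + 1 / (n - 2)) * ∑ i,
        partialD i (fun y => ‖y‖ ^ (α - 2) * (y i * ∑ k, partialD k u y * partialD k u y)) x
      - (2 - (n - 3) * α / (n - 2)) * ∑ i,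
        partialD i (fun y => ‖y‖ ^ (α - 2) * ((∑ k, y k * partialD k u y) * partialD i u y)) x
      - ((n - 2 + α) / 2 - (α - 2) / (n - 2)) * ∑ i,
        partialD i (fun y => ‖y‖ ^ (α - 4) *
          (y i * ((∑ k, y k * partialD k u y) * ∑ k, y k * partialD k u y))) x := by
  have hp : ∀ i, PuncturedTest 1 (partialD i u) := fun i => hu.partialD (by norm_num) i
  have hs : PuncturedTest 1 fun x => ∑ i, x i * partialD i u x :=
    PuncturedTest.sum _ fun i _ => (hp i).coord_mul i
  have hpp : PuncturedTest 1 fun x => ∑ i, partialD i u x * partialD i u x :=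
    PuncturedTest.sum _ fun i _ => (hp i).mul (hp i)
  have hr : ‖x‖ ≠ 0 := norm_ne_zero_iff.2 hx
  have hρ := EuclideanSpace.real_norm_sq_eq x
  have w1 : ‖x‖ ^ (α - 2) = ‖x‖ ^ (α - 4) * ∑ i, x i ^ 2 := by
    rw [← hρ, ← Real.rpow_add_natCast hr]
    congr 1; push_cast; ring
  have w2 : ‖x‖ ^ α = ‖x‖ ^ (α - 4) * (∑ i, x i ^ 2) ^ 2 := by
    rw [← hρ, ← pow_mul, ← Real.rpow_add_natCast hr]
    congr 1; push_cast; ring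
  have hρ0 : 0 < ∑ i, x i ^ 2 := hρ ▸ by positivity
  obtain ⟨p, hpx⟩ : ∃ p : Fin n → ℝ, ∀ i, partialD i u x = p i := ⟨_, fun _ => rfl⟩
  obtain ⟨Q, hQx⟩ : ∃ Q : Fin n → Fin n → ℝ, ∀ i j, partialD j (partialD i u) x = Q i j :=
    ⟨_, fun _ _ => rfl⟩
  have hQs : ∀ i j, Q i j = Q j i := fun i j => by
    rw [← hQx, ← hQx, partialD_partialD_comm hu.contDiff]
  obtain ⟨b, hb⟩ : ∃ b : Fin n → ℝ, ∀ i, b i = ∑ j, Q i j * x j := ⟨_, fun _ => rfl⟩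
  have ds : ∀ j, partialD j (fun y => ∑ k, y k * partialD k u y) x = p j + b j := by
    intro j
    rw [partialD_sum _ _ fun k _ => ((hp k).coord_mul k).differentiableAt x]
    simp only [partialD_coord_mul ((hp _).differentiableAt x), Finset.sum_add_distrib, hb,
      hpx, hQx]
    congr 1
    · simp [ite_mul]
    · exact Finset.sum_congr rfl fun k _ => by rw [hQs j k, mul_comm]
  have dpp : ∀ j, partialD j (fun y => ∑ k, partialD k u y * partialD k u y) x =
      2 * ∑ k, p k * Q k j := by
    intro j
    rw [partialD_sum _ _ fun k _ => ((hp k).mul (hp k)).differentiableAt x, Finset.mul_sum]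
    refine Finset.sum_congr rfl fun k _ => ?_
    rw [partialD_mul _ ((hp k).differentiableAt x) ((hp k).differentiableAt x)]
    rw [hpx, hQx]
    ring
  have hpb : ∑ i, x i * ∑ k, p k * Q k i = ∑ i, p i * b i := by
    simp only [hb, Finset.mul_sum]
    rw [Finset.sum_comm]
    exact Finset.sum_congr rfl fun i _ => Finset.sum_congr rfl fun k _ => by ring
  have e1 := sum_null_lagrangian_weighted x p Q hQs (α * ‖x‖ ^ (α - 2)) (‖x‖ ^ α)
  have e2 := sum_null_lagrangian_radial x p Q b hb ((α - 2) * ‖x‖ ^ (α - 2 - 2))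
    (‖x‖ ^ (α - 2)) _ rfl
  have e3 := sum_partialD_norm_rpow_mul_coord_mul hx (hpp.differentiableAt x) (α - 2)
  have e4 := sum_partialD_norm_rpow_mul hx
    (fun i => (hs.mul (hp i)).differentiableAt x) (α - 2)
  have e5 := sum_partialD_norm_rpow_mul_coord_mul hx ((hs.mul hs).differentiableAt x) (α - 4)
  have hn' : (2 : ℝ) < n := by exact_mod_cast (by omega : 2 < n)
  have c2 : (∑ i, x i * (b i + (n - 2 + α) / 2 * p i)) ^ 2 ≤
      (∑ i, x i ^ 2) * ∑ i, (b i + (n - 2 + α) / 2 * p i) ^ 2 :=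
    Finset.sum_mul_sq_le_sq_mul_sq _ _ _
  have c4 : (∑ i, x i * p i) ^ 2 ≤ (∑ i, x i ^ 2) * ∑ i, p i ^ 2 :=
    Finset.sum_mul_sq_le_sq_mul_sq _ _ _
  have c3 := sq_tangential_trace_le x Q hQs (by omega) b hb hρ0
  have d1 : ∑ i, x i * (b i + (n - 2 + α) / 2 * p i) =
      ∑ i, x i * b i + (n - 2 + α) / 2 * ∑ i, x i * p i := by
    rw [Finset.mul_sum, ← Finset.sum_add_distrib]
    exact Finset.sum_congr rfl fun i _ => by ring
  have d2 : ∑ i, (b i + (n - 2 + α) / 2 * p i) ^ 2 =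
      ∑ i, b i ^ 2 + (n - 2 + α) * ∑ i, p i * b i + ((n - 2 + α) / 2) ^ 2 * ∑ i, p i ^ 2 := by
    rw [Finset.mul_sum, Finset.mul_sum, ← Finset.sum_add_distrib, ← Finset.sum_add_distrib]
    exact Finset.sum_congr rfl fun i _ => by ring
  rw [d1, d2] at c2
  have key := mul_nonneg (Real.rpow_nonneg (norm_nonneg x) (α - 4))
    (rellich_density_nonneg hn' hα (sub_nonneg.2 c2) c3 c4)
  have hd : ∀ i : Fin n, DifferentiableAt ℝ
      (fun y : EuclideanSpace ℝ (Fin n) => y i * ∑ k, y k * partialD k u y) x :=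
    fun i => (hs.coord_mul i).differentiableAt x
  have q3 : ∑ i, x i * (2 * ∑ k, p k * Q k i) = 2 * ∑ i, p i * b i := by
    rw [← hpb, Finset.mul_sum]
    exact Finset.sum_congr rfl fun i _ => by ring
  have q4 : ∑ i, ((p i + b i) * p i + (∑ k, x k * p k) * Q i i) =
      ∑ i, p i * b i + ∑ i, p i ^ 2 + (∑ k, x k * p k) * ∑ i, Q i i := by
    rw [Finset.mul_sum, ← Finset.sum_add_distrib, ← Finset.sum_add_distrib]
    exact Finset.sum_congr rfl fun i _ => by ring
  have q4' : ∑ i, x i * ((∑ k, x k * p k) * p i) = (∑ k, x k * p k) ^ 2 := by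
    rw [sq, Finset.mul_sum]
    exact Finset.sum_congr rfl fun i _ => by ring
  have q5 : ∑ i, x i * ((p i + b i) * (∑ k, x k * p k) + (∑ k, x k * p k) * (p i + b i)) =
      2 * (∑ k, x k * p k) * (∑ k, x k * p k + ∑ k, x k * b k) := by
    rw [← Finset.sum_add_distrib, Finset.mul_sum]
    exact Finset.sum_congr rfl fun i _ => by ring
  have q6 : ∑ i, p i * ∑ j, Q i j * x j = ∑ i, p i * b i := by simp only [hb]
  have w3 : α - 2 - 2 = α - 4 := by ring
  have hsp : ∀ i, partialD i (fun y => (∑ k, y k * partialD k u y) * partialD i u y) x =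
      (p i + b i) * p i + (∑ k, x k * p k) * Q i i := fun i => by
    rw [partialD_mul _ (hs.differentiableAt x) ((hp i).differentiableAt x), ds]
    simp only [hpx, hQx]
  have hss : ∀ i, partialD i
      (fun y => (∑ k, y k * partialD k u y) * ∑ k, y k * partialD k u y) x =
      (p i + b i) * (∑ k, x k * p k) + (∑ k, x k * p k) * (p i + b i) := fun i => by
    rw [partialD_mul _ (hs.differentiableAt x) (hs.differentiableAt x), ds]
    simp only [hpx]
  have g1 : ∑ i, ∑ j,
      (partialD i (fun y => ‖y‖ ^ α * partialD i u y) x * partialD j (partialD j u) x -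
        partialD j (fun y => ‖y‖ ^ α * partialD i u y) x * partialD i (partialD j u) x) = _ :=
    Eq.trans (Finset.sum_congr rfl fun i _ => Finset.sum_congr rfl fun j _ => by
      simp only [partialD_norm_rpow_mul hx ((hp _).differentiableAt x), hpx, hQx]) e1
  have g2 : ∑ i, ∑ j,
      (partialD i (fun y => ‖y‖ ^ (α - 2) * (y i * ∑ k, y k * partialD k u y)) x *
          partialD j (partialD j u) x -
        partialD j (fun y => ‖y‖ ^ (α - 2) * (y i * ∑ k, y k * partialD k u y)) x *
          partialD i (partialD j u) x) = _ :=
    Eq.trans (Finset.sum_congr rfl fun i _ => Finset.sum_congr rfl fun j _ => by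
      simp only [partialD_norm_rpow_mul hx (hd _), partialD_coord_mul (hs.differentiableAt x),
        ds, hpx, hQx]) e2
  rw [g1, g2, e3, e4, e5]
  simp only [hsp, hss, dpp, hpx, hQx, q3, q4, q4', q5, q6, w3, w1, w2]
  simp only [← sq]
  refine key.trans_eq ?_
  ring

theorem mul_integral_le_of_ae_nonneg_add {X : Type*} [MeasurableSpace X] {μ : Measure X}
    {F P G₁ G₂ G₃ G₄ G₅ : X → ℝ} (iF : Integrable F μ) (iP : Integrable P μ)
    (i₁ : Integrable G₁ μ) (i₂ : Integrable G₂ μ) (i₃ : Integrable G₃ μ) (i₄ : Integrable G₄ μ)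
    (i₅ : Integrable G₅ μ) (z₁ : ∫ x, G₁ x ∂μ = 0) (z₂ : ∫ x, G₂ x ∂μ = 0)
    (z₃ : ∫ x, G₃ x ∂μ = 0) (z₄ : ∫ x, G₄ x ∂μ = 0) (z₅ : ∫ x, G₅ x ∂μ = 0)
    {B c₁ c₂ c₃ c₄ c₅ : ℝ}
    (h : ∀ᵐ x ∂μ, 0 ≤ F x - B * P x - c₁ * G₁ x + c₂ * G₂ x + c₃ * G₃ x - c₄ * G₄ x - c₅ * G₅ x) :
    B * ∫ x, P x ∂μ ≤ ∫ x, F x ∂μ := by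
  have hint := integral_nonneg_of_ae h
  rw [integral_sub (by fun_prop) (by fun_prop), integral_sub (by fun_prop) (by fun_prop),
    integral_add (by fun_prop) (by fun_prop), integral_add (by fun_prop) (by fun_prop),
    integral_sub (by fun_prop) (by fun_prop), integral_sub (by fun_prop) (by fun_prop)] at hint
  simp only [integral_const_mul, z₁, z₂, z₃, z₄, z₅] at hint
  linarith

/-- The weighted Rellich–Hardy inequality with the radial constant. -/
theorem rellich_hardy {n : ℕ} (hn : 3 ≤ n) (α : ℝ)
    (hα : ((n - α) / 2) ^ 2 - (n - 4 + α) * (n - α) / 2 ≤ (n : ℝ) - 1)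
    {u : EuclideanSpace ℝ (Fin n) → ℝ} (hu : PuncturedTest 2 u) :
    ((n - α) / 2) ^ 2 * (∫ x, ‖x‖ ^ (α - 2) * ∑ i, partialD i u x ^ 2) ≤
      ∫ x, ‖x‖ ^ α * (∑ i, partialD i (partialD i u) x) ^ 2 := by
  have hp : ∀ i, PuncturedTest 1 (partialD i u) := fun i => hu.partialD (by norm_num) i
  have hQ : ∀ i j, PuncturedTest 0 (partialD i (partialD j u)) := fun i j =>
    (hp j).partialD (by simp) i
  have hs : PuncturedTest 1 fun x => ∑ i, x i * partialD i u x :=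
    PuncturedTest.sum _ fun i _ => (hp i).coord_mul i
  have hpp : PuncturedTest 1 fun x => ∑ i, partialD i u x * partialD i u x :=
    PuncturedTest.sum _ fun i _ => (hp i).mul (hp i)
  have hT : PuncturedTest 0 fun x => ∑ i, partialD i (partialD i u) x :=
    PuncturedTest.sum _ fun i _ => hQ i i
  have f1 : ∀ i, PuncturedTest 1 fun x => ‖x‖ ^ α * partialD i u x := fun i =>
    (hp i).norm_rpow_mul α
  have f2 : ∀ i : Fin n, PuncturedTest 1 fun x =>
      ‖x‖ ^ (α - 2) * (x i * ∑ k, x k * partialD k u x) := fun i =>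
    (hs.coord_mul i).norm_rpow_mul _
  have f3 : ∀ i : Fin n, PuncturedTest 1 fun x =>
      ‖x‖ ^ (α - 2) * (x i * ∑ k, partialD k u x * partialD k u x) := fun i =>
    (hpp.coord_mul i).norm_rpow_mul _
  have f4 : ∀ i : Fin n, PuncturedTest 1 fun x =>
      ‖x‖ ^ (α - 2) * ((∑ k, x k * partialD k u x) * partialD i u x) := fun i =>
    (hs.mul (hp i)).norm_rpow_mul _
  have f5 : ∀ i : Fin n, PuncturedTest 1 fun x =>
      ‖x‖ ^ (α - 4) * (x i * ((∑ k, x k * partialD k u x) * ∑ k, x k * partialD k u x)) :=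
    fun i => ((hs.mul hs).coord_mul i).norm_rpow_mul _
  have hn0 : NeZero n := ⟨by omega⟩
  have hpt : ∀ᵐ x : EuclideanSpace ℝ (Fin n), x ≠ 0 := Measure.ae_ne volume 0
  simp only [sq (Finset.sum _ _), sq (partialD _ _ _)]
  exact mul_integral_le_of_ae_nonneg_add ((hT.mul hT).norm_rpow_mul α).integrable
    (hpp.norm_rpow_mul (α - 2)).integrable
    (PuncturedTest.null_lagrangian f1 hp).integrable
    (PuncturedTest.null_lagrangian f2 hp).integrable
    (PuncturedTest.divergence f3).integrable (PuncturedTest.divergence f4).integrable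
    (PuncturedTest.divergence f5).integrable
    (PuncturedTest.integral_null_lagrangian_eq_zero f1 hp)
    (PuncturedTest.integral_null_lagrangian_eq_zero f2 hp)
    (PuncturedTest.integral_divergence_eq_zero f3) (PuncturedTest.integral_divergence_eq_zero f4)
    (PuncturedTest.integral_divergence_eq_zero f5)
    (hpt.mono fun x hx => rellich_hardy_pointwise hn α hα hu hx)

theorem statement19 (n : ℕ) (hn : 3 ≤ n) (α : ℝ)
    (hα1 : 4 - (n : ℝ) < α) (hα2 : α < 2)
    (hex : ∃ u : EuclideanSpace ℝ (Fin n) → ℝ,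
      ContDiff ℝ 2 u ∧ HasCompactSupport u ∧
      (0 : EuclideanSpace ℝ (Fin n)) ∉ tsupport u ∧
      (∫ x : EuclideanSpace ℝ (Fin n), ‖x‖ ^ (α - 2) * ‖gradient u x‖ ^ 2) ≠ 0 ∧
      (∫ x : EuclideanSpace ℝ (Fin n), ‖x‖ ^ α * (lap u x) ^ 2) <
        (((n : ℝ) - α) / 2) ^ 2 *
          (∫ x : EuclideanSpace ℝ (Fin n), ‖x‖ ^ (α - 2) * ‖gradient u x‖ ^ 2)) :
    (((n : ℝ) - α) / 2) ^ 2 - ((n : ℝ) - 4 + α) * ((n : ℝ) - α) / 2 > (n : ℝ) - 1 ∧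
    3 * α ^ 2 - 2 * ((n : ℝ) + 4) * α - (n : ℝ) ^ 2 + 4 * n + 4 > 0 ∧
    α < ((n : ℝ) + 4 - 2 * Real.sqrt ((n : ℝ) ^ 2 - n + 1)) / 3 := by
  obtain ⟨u, hu, huc, hu0, -, hlt⟩ := hex
  have hn' : (3 : ℝ) ≤ n := by exact_mod_cast hn
  have h1 : (((n : ℝ) - α) / 2) ^ 2 - ((n : ℝ) - 4 + α) * ((n : ℝ) - α) / 2 > (n : ℝ) - 1 := by
    by_contra! hα
    simp only [lap_eq_sum_partialD hu, norm_gradient_sq_eq_sum] at hlt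
    exact hlt.not_ge <| rellich_hardy hn α hα
      ⟨hu, huc, notMem_tsupport_iff_eventuallyEq.1 hu0⟩
  have h2 : 3 * α ^ 2 - 2 * ((n : ℝ) + 4) * α - (n : ℝ) ^ 2 + 4 * n + 4 > 0 := by
    linarith
  refine ⟨h1, h2, ?_⟩
  have h3 : Real.sqrt ((n : ℝ) ^ 2 - n + 1) < (n + 4 - 3 * α) / 2 := by
    rw [Real.sqrt_lt' (by linarith)]
    linarith
  linarith
end
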